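/- Let U ∈ 𝔖_F(𝕊_1^+) with F satisfying |F(X,t)| ≤ C_ℓ |(X,t)|^{ℓ−2} on 𝕊_1^+ for some ℓ ≥ 2 and C_ℓ > 0, fix σ ∈ (0,1), and let κ = Φ_{ℓ,σ}(U,0⁺) (the limit from the Almgren–Poon monotonicity formula). Then κ ≤ ℓ − 1 + σ. Furthermore, if κ < ℓ − 1 + σ, then there exists r₀ = r₀(U) > 0 such that H(U,r) ≥ r^{2ℓ−2+2σ} for every r ∈ (0,r₀), and in this case κ = lim_{r→0⁺} r H′(U,r)/(2 H(U,r)) = lim_{r→0⁺} N(U,r) = lim_{r→0⁺} Ñ(U,r). -/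

import Mathlib

/- Formalization of results from "The structure of the singular set in the thin obstacle
problem for degenerate parabolic equations" by Banerjee, Danielli, Garofalo, Petrosyan.

Points of ℝ^{n+1} are written X = (x,y) with x : Fin n → ℝ and y : ℝ; functions of
space-time are `U : (Fin n → ℝ) → ℝ → ℝ → ℝ`, with `U x y t`. -/

noncomputable section

open MeasureTheory Filter Topology

/-- Functions on ℝⁿ × ℝ × ℝ, written `U x y t` for `X = (x,y)` and time `t`. -/
abbrev Fn (n : ℕ) := (Fin n → ℝ) → ℝ → ℝ → ℝ

/-- Space-time points `(x, y, t)`. -/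
abbrev Pt (n : ℕ) := (Fin n → ℝ) × ℝ × ℝ

/-- Partial derivative in the direction of the i-th thin coordinate. -/
def pdx {n : ℕ} (i : Fin n) (U : Fn n) (x : Fin n → ℝ) (y t : ℝ) : ℝ :=
  fderiv ℝ (fun x' => U x' y t) x (Pi.single i 1)

/-- Partial derivative in the extension variable y. -/
def pdy {n : ℕ} (U : Fn n) (x : Fin n → ℝ) (y t : ℝ) : ℝ :=
  deriv (fun y' => U x y' t) y

/-- Time derivative. -/
def pdt {n : ℕ} (U : Fn n) (x : Fin n → ℝ) (y t : ℝ) : ℝ :=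
  deriv (fun t' => U x y t') t

/-- Squared norm |∇U|² of the full spatial gradient. -/
def gradSq {n : ℕ} (U : Fn n) (x : Fin n → ℝ) (y t : ℝ) : ℝ :=
  (∑ i, (pdx i U x y t) ^ 2) + (pdy U x y t) ^ 2

/-- |∇V − ∇W|². -/
def gradDiffSq {n : ℕ} (V W : Fn n) (x : Fin n → ℝ) (y t : ℝ) : ℝ :=
  (∑ i, (pdx i V x y t - pdx i W x y t) ^ 2) + (pdy V x y t - pdy W x y t) ^ 2

/-- The generator Z f = ⟨X, ∇f⟩ + 2 t ∂ₜ f of the parabolic dilations. -/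
def Zop {n : ℕ} (U : Fn n) (x : Fin n → ℝ) (y t : ℝ) : ℝ :=
  (∑ i, x i * pdx i U x y t) + y * pdy U x y t + 2 * t * pdt U x y t

/-- Laplacian in the x variables only. -/
def lapx {n : ℕ} (U : Fn n) (x : Fin n → ℝ) (y t : ℝ) : ℝ :=
  ∑ i, pdx i (fun x' y' t' => pdx i U x' y' t') x y t

/-- Second derivative in y. -/
def pdyy {n : ℕ} (U : Fn n) (x : Fin n → ℝ) (y t : ℝ) : ℝ :=
  pdy (fun x' y' t' => pdy U x' y' t') x y t

/-- Full spatial Laplacian in the variables X = (x,y). -/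
def lapFull {n : ℕ} (U : Fn n) (x : Fin n → ℝ) (y t : ℝ) : ℝ :=
  lapx U x y t + pdyy U x y t

/-- |X|² for X = (x,y). -/
def nsq {n : ℕ} (x : Fin n → ℝ) (y : ℝ) : ℝ := (∑ i, (x i) ^ 2) + y ^ 2

/-- The backward Neumann fundamental solution Ḡ_a(X,t), for t < 0. -/
def Gbar (n : ℕ) (a : ℝ) (x : Fin n → ℝ) (y t : ℝ) : ℝ :=
  (4 * Real.pi) ^ (-(n : ℝ) / 2) / ((2:ℝ) ^ a * Real.Gamma ((a + 1) / 2)) *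
    |t| ^ (-((n : ℝ) + a + 1) / 2) * Real.exp (-(nsq x y) / (4 * |t|))

/-- The half-strip 𝕊_r⁺ = ℝ^{n+1}_+ × (−r², 0]. -/
def Splus (n : ℕ) (r : ℝ) : Set (Pt n) :=
  {p | 0 < p.2.1 ∧ p.2.2 ∈ Set.Ioc (-(r ^ 2)) 0}

/-- The Gaussian weight Ḡ_a(X,t) yᵃ. -/
def wgt (n : ℕ) (a : ℝ) (p : Pt n) : ℝ :=
  Gbar n a p.1 p.2.1 p.2.2 * p.2.1 ^ a

/-- The height function H(U,r). -/
def Hfn (n : ℕ) (a : ℝ) (U : Fn n) (r : ℝ) : ℝ :=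
  (1 / r ^ 2) * ∫ p in Splus n r, (U p.1 p.2.1 p.2.2) ^ 2 * wgt n a p

/-- The energy D(U,r). -/
def Dfn (n : ℕ) (a : ℝ) (U : Fn n) (r : ℝ) : ℝ :=
  (1 / r ^ 2) * ∫ p in Splus n r, |p.2.2| * gradSq U p.1 p.2.1 p.2.2 * wgt n a p

/-- The total energy I(U,r). -/
def Ifn (n : ℕ) (a : ℝ) (U : Fn n) (r : ℝ) : ℝ :=
  (1 / (2 * r ^ 2)) * ∫ p in Splus n r, U p.1 p.2.1 p.2.2 * Zop U p.1 p.2.1 p.2.2 * wgt n a p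

/-- The set of thin points in S₁ where both U and its weighted normal derivative
∂_yᵃ U vanish.  The extended free boundary Γ_*(U) is its boundary in S₁. -/
def ZeroSet (n : ℕ) (a : ℝ) (U : Fn n) : Set ((Fin n → ℝ) × ℝ) :=
  {q | q.2 ∈ Set.Ioc (-1 : ℝ) 0 ∧ U q.1 0 q.2 = 0 ∧
    Tendsto (fun y => y ^ a * pdy U q.1 y q.2) (𝓝[>] (0 : ℝ)) (𝓝 0)}

/-- The Signorini class 𝔖_F(𝕊₁⁺). -/
structure SignoriniMem (n : ℕ) (a : ℝ) (F U : Fn n) : Prop where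
  /-- continuity up to the thin space -/
  cont : ContinuousOn (fun p : Pt n => U p.1 p.2.1 p.2.2)
    {p : Pt n | 0 ≤ p.2.1 ∧ p.2.2 ∈ Set.Ioc (-1 : ℝ) 0}
  /-- bounded support in the space variables -/
  bddSupp : ∃ R > (0:ℝ), ∀ x y t, R ^ 2 ≤ nsq x y → U x y t = 0
  /-- smoothness in {y > 0} -/
  smooth : ∀ x y t, 0 < y → t ∈ Set.Ioc (-1 : ℝ) 0 →
    ContDiffAt ℝ (⊤ : ℕ∞) (fun p : Pt n => U p.1 p.2.1 p.2.2) (x, y, t)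
  /-- the equation yᵃ ∂ₜU = div(yᵃ ∇U) + yᵃ F holds classically in {y > 0} -/
  pde : ∀ x y t, 0 < y → t ∈ Set.Ioc (-1 : ℝ) 0 →
    pdt U x y t = lapFull U x y t + (a / y) * pdy U x y t + F x y t
  /-- ∇ₓU extends parabolically Hölder continuously up to {y = 0} -/
  holderX : ∃ α > (0:ℝ), ∃ C : ℝ, ∀ i : Fin n, ∀ x y t x' y' t',
    0 < y → 0 < y' → t ∈ Set.Ioc (-1 : ℝ) 0 → t' ∈ Set.Ioc (-1 : ℝ) 0 →
    |pdx i U x y t - pdx i U x' y' t'| ≤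
      C * ((∑ j, (x j - x' j) ^ 2) + (y - y') ^ 2 + |t - t'|) ^ (α / 2)
  /-- yᵃ ∂_y U extends parabolically Hölder continuously up to {y = 0} -/
  holderY : ∃ α > (0:ℝ), ∃ C : ℝ, ∀ x y t x' y' t',
    0 < y → 0 < y' → t ∈ Set.Ioc (-1 : ℝ) 0 → t' ∈ Set.Ioc (-1 : ℝ) 0 →
    |y ^ a * pdy U x y t - y' ^ a * pdy U x' y' t'| ≤
      C * ((∑ j, (x j - x' j) ^ 2) + (y - y') ^ 2 + |t - t'|) ^ (α / 2)
  /-- ∂ₜU ∈ L^∞(𝕊₁⁺) -/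
  bddTime : ∃ M : ℝ, ∀ x y t, 0 < y → t ∈ Set.Ioc (-1 : ℝ) 0 → |pdt U x y t| ≤ M
  /-- yᵃ |∇ ∂ₓᵢ U|² integrable on 𝕊₁⁺ -/
  intXX : ∀ i : Fin n, IntegrableOn
    (fun p : Pt n => p.2.1 ^ a * gradSq (fun x y t => pdx i U x y t) p.1 p.2.1 p.2.2)
    (Splus n 1)
  /-- y^{−a} (∂_y(yᵃ ∂_y U))² integrable on 𝕊₁⁺ -/
  intYY : IntegrableOn
    (fun p : Pt n => p.2.1 ^ (-a) *
      (pdy (fun x y t => y ^ a * pdy U x y t) p.1 p.2.1 p.2.2) ^ 2) (Splus n 1)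
  /-- U ≥ 0 on the thin space -/
  nonneg : ∀ x, ∀ t ∈ Set.Ioc (-1 : ℝ) 0, 0 ≤ U x 0 t
  /-- the Signorini complementarity conditions on the thin space -/
  signorini : ∀ x, ∀ t ∈ Set.Ioc (-1 : ℝ) 0, ∃ L ≤ (0:ℝ),
    Tendsto (fun y => y ^ a * pdy U x y t) (𝓝[>] (0 : ℝ)) (𝓝 L) ∧ U x 0 t * L = 0
  /-- (0,0) belongs to the extended free boundary Γ_*(U) -/
  originFB : (0, 0) ∈ closure (ZeroSet n a U) ∧
    (0, 0) ∈ closure ({q : (Fin n → ℝ) × ℝ | q.2 ∈ Set.Ioc (-1 : ℝ) 0} \ ZeroSet n a U)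

/-- The growth bound |F(X,t)| ≤ C_ℓ |(X,t)|^{ℓ−2} on 𝕊₁⁺. -/
def FGrowth (n : ℕ) (F : Fn n) (l Cl : ℝ) : Prop :=
  ∀ x y t, 0 < y → t ∈ Set.Ioc (-1 : ℝ) 0 →
    |F x y t| ≤ Cl * (nsq x y + |t|) ^ ((l - 2) / 2)

/-- The growth bound |∇_X F(X,t)| ≤ C_ℓ |(X,t)|^{ℓ−3} on 𝔹_{1/2}⁺ × (−1/4, 0]. -/
def FGradGrowth (n : ℕ) (F : Fn n) (l Cl : ℝ) : Prop :=
  ∀ x y t, 0 < y → nsq x y < (1/2 : ℝ) ^ 2 → t ∈ Set.Ioc (-(1/4 : ℝ)) 0 →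
    Real.sqrt (gradSq F x y t) ≤ Cl * (nsq x y + |t|) ^ ((l - 3) / 2)

/-- The growth bound |∂ₜF(X,t)| ≤ C_ℓ |(X,t)|^{ℓ−4} on 𝔹_{1/2}⁺ × (−1/4, 0]. -/
def FTimeGrowth (n : ℕ) (F : Fn n) (l Cl : ℝ) : Prop :=
  ∀ x y t, 0 < y → nsq x y < (1/2 : ℝ) ^ 2 → t ∈ Set.Ioc (-(1/4 : ℝ)) 0 →
    |pdt F x y t| ≤ Cl * (nsq x y + |t|) ^ ((l - 4) / 2)

/-- r ↦ log max{H(U,r), r^{2ℓ−2+2σ}}. -/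
def logMaxH (n : ℕ) (a : ℝ) (U : Fn n) (l σ : ℝ) (r : ℝ) : ℝ :=
  Real.log (max (Hfn n a U r) (r ^ (2 * l - 2 + 2 * σ)))

/-- The set of radii in (0,1) where `logMaxH` is differentiable (it is locally
Lipschitz, hence this set has full measure). -/
def diffSet (n : ℕ) (a : ℝ) (U : Fn n) (l σ : ℝ) : Set ℝ :=
  {r | r ∈ Set.Ioo (0 : ℝ) 1 ∧ DifferentiableAt ℝ (logMaxH n a U l σ) r}

/-- The truncated Almgren–Poon frequency Φ_{ℓ,σ}(U,·), with constant C. -/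
def Phi (n : ℕ) (a : ℝ) (U : Fn n) (l σ C : ℝ) (r : ℝ) : ℝ :=
  (1/2) * r * Real.exp (C * r ^ (1 - σ)) * deriv (logMaxH n a U l σ) r
    + 2 * (Real.exp (C * r ^ (1 - σ)) - 1)

/-- The parabolic Almgren rescalings U_r. -/
def rescale (n : ℕ) (a : ℝ) (U : Fn n) (r : ℝ) : Fn n :=
  fun x y t => U (r • x) (r * y) (r ^ 2 * t) / Real.sqrt (Hfn n a U r)

/-- The Weiss functional 𝒲_κ(U,r). -/
def Wfn (n : ℕ) (a : ℝ) (U : Fn n) (κ r : ℝ) : ℝ :=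
  r ^ (-(2 * κ)) * (Dfn n a U r - κ / 2 * Hfn n a U r)

/-- The Monneau functional M_κ(U,p_κ,r). -/
def Mfn (n : ℕ) (a : ℝ) (U pk : Fn n) (κ r : ℝ) : ℝ :=
  r ^ (-(2 * κ + 2)) *
    ∫ p in Splus n r, (U p.1 p.2.1 p.2.2 - pk p.1 p.2.1 p.2.2) ^ 2 * wgt n a p

/-- Polynomial functions of (x,t). -/
def IsPolyFun2 (n : ℕ) (q : (Fin n → ℝ) → ℝ → ℝ) : Prop :=
  ∃ P : MvPolynomial (Fin (n + 1)) ℝ, ∀ x t, q x t = MvPolynomial.eval (Fin.snoc x t) P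

/-- Polynomial functions of (x,y,t). -/
def IsPolyFun3 (n : ℕ) (q : Fn n) : Prop :=
  ∃ P : MvPolynomial (Fin (n + 2)) ℝ, ∀ x y t,
    q x y t = MvPolynomial.eval (Fin.snoc (Fin.snoc x y) t) P

/-- The class 𝒫_κ⁺ of parabolically κ-homogeneous, even in y, a-caloric polynomials
which are nonnegative on the thin space. -/
def Pkappa (n : ℕ) (a κ : ℝ) (p : Fn n) : Prop :=
  IsPolyFun3 n p ∧
  (∀ lam > (0:ℝ), ∀ x y t, p (lam • x) (lam * y) (lam ^ 2 * t) = lam ^ κ * p x y t) ∧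
  (∀ x y t, p x (-y) t = p x y t) ∧
  (∀ x t, 0 ≤ p x 0 t) ∧
  (∀ x y t, y ≠ 0 →
    pdt p x y t - lapx p x y t - pdyy p x y t - (a / y) * pdy p x y t = 0)

/-- The coincidence set Λ(U) ⊆ S₁. -/
def Lam (n : ℕ) (U : Fn n) : Set ((Fin n → ℝ) × ℝ) :=
  {q | q.2 ∈ Set.Ioc (-1 : ℝ) 0 ∧ U q.1 0 q.2 = 0}

/-- The thin parabolic cylinder Q_r = B_r × (−r²,0]. -/
def Qthin (n : ℕ) (r : ℝ) : Set ((Fin n → ℝ) × ℝ) :=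
  {q | (∑ i, (q.1 i) ^ 2) < r ^ 2 ∧ q.2 ∈ Set.Ioc (-(r ^ 2)) 0}

/-- The modified Bessel function of the first kind I_ν(z). -/
def besselI (ν z : ℝ) : ℝ :=
  ∑' k : ℕ, (z / 2) ^ (ν + 2 * (k : ℝ)) /
    (Real.Gamma ((k : ℝ) + 1) * Real.Gamma ((k : ℝ) + ν + 1))

/-- The Bessel heat kernel p^{(a)}(y,η,t). -/
def pker (a y η t : ℝ) : ℝ :=
  (2 * t) ^ (-(a + 1) / 2) * (y * η / (2 * t)) ^ ((1 - a) / 2) *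
    besselI ((a - 1) / 2) (y * η / (2 * t)) * Real.exp (-(y ^ 2 + η ^ 2) / (4 * t))

/-- `V` is smooth at the space-time point `p`. -/
def SmoothAt {n : ℕ} (V : Fn n) (p : Pt n) : Prop :=
  ContDiffAt ℝ (⊤ : ℕ∞) (fun q : Pt n => V q.1 q.2.1 q.2.2) p

section PartialDerivatives

variable {n : ℕ} {V W : Fn n} {p : Pt n} {x : Fin n → ℝ} {y t : ℝ}

lemma SmoothAt.differentiableAt (h : SmoothAt V p) :
    DifferentiableAt ℝ (fun q : Pt n => V q.1 q.2.1 q.2.2) p :=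
  ContDiffAt.differentiableAt h (by simp)

lemma hasFDerivAt_slice_x (h : DifferentiableAt ℝ (fun q : Pt n => V q.1 q.2.1 q.2.2) (x, y, t)) :
    HasFDerivAt (fun x' => V x' y t)
      ((fderiv ℝ (fun q : Pt n => V q.1 q.2.1 q.2.2) (x, y, t)).comp
        (ContinuousLinearMap.inl ℝ (Fin n → ℝ) (ℝ × ℝ))) x :=
  HasFDerivAt.comp x (f := fun x' : Fin n → ℝ => ((x', y, t) : Pt n)) h.hasFDerivAt
    (hasFDerivAt_prodMk_left x (y, t))

lemma hasDerivAt_slice_y (h : DifferentiableAt ℝ (fun q : Pt n => V q.1 q.2.1 q.2.2) (x, y, t)) :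
    HasDerivAt (fun y' => V x y' t)
      (fderiv ℝ (fun q : Pt n => V q.1 q.2.1 q.2.2) (x, y, t) (0, 1, 0)) y :=
  HasFDerivAt.comp_hasDerivAt y (f := fun y' : ℝ => ((x, y', t) : Pt n)) h.hasFDerivAt
    ((hasDerivAt_const y x).prodMk ((hasDerivAt_id y).prodMk (hasDerivAt_const y t)))

lemma hasDerivAt_slice_t (h : DifferentiableAt ℝ (fun q : Pt n => V q.1 q.2.1 q.2.2) (x, y, t)) :
    HasDerivAt (fun t' => V x y t')
      (fderiv ℝ (fun q : Pt n => V q.1 q.2.1 q.2.2) (x, y, t) (0, 0, 1)) t :=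
  HasFDerivAt.comp_hasDerivAt t (f := fun t' : ℝ => ((x, y, t') : Pt n)) h.hasFDerivAt
    ((hasDerivAt_const t x).prodMk ((hasDerivAt_const t y).prodMk (hasDerivAt_id t)))

lemma pdx_eq_fderiv (i : Fin n)
    (h : DifferentiableAt ℝ (fun q : Pt n => V q.1 q.2.1 q.2.2) (x, y, t)) :
    pdx i V x y t =
      fderiv ℝ (fun q : Pt n => V q.1 q.2.1 q.2.2) (x, y, t) (Pi.single i 1, 0, 0) := by
  rw [pdx, (hasFDerivAt_slice_x h).fderiv]; rfl

lemma pdy_eq_fderiv (h : DifferentiableAt ℝ (fun q : Pt n => V q.1 q.2.1 q.2.2) (x, y, t)) :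
    pdy V x y t = fderiv ℝ (fun q : Pt n => V q.1 q.2.1 q.2.2) (x, y, t) (0, 1, 0) :=
  (hasDerivAt_slice_y h).deriv

lemma pdt_eq_fderiv (h : DifferentiableAt ℝ (fun q : Pt n => V q.1 q.2.1 q.2.2) (x, y, t)) :
    pdt V x y t = fderiv ℝ (fun q : Pt n => V q.1 q.2.1 q.2.2) (x, y, t) (0, 0, 1) :=
  (hasDerivAt_slice_t h).deriv

lemma SmoothAt.hasDerivAt_pdy (h : SmoothAt V (x, y, t)) :
    HasDerivAt (fun y' => V x y' t) (pdy V x y t) y := by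
  rw [pdy_eq_fderiv h.differentiableAt]; exact hasDerivAt_slice_y h.differentiableAt

lemma Zop_eq_fderiv (h : DifferentiableAt ℝ (fun q : Pt n => V q.1 q.2.1 q.2.2) (x, y, t)) :
    Zop V x y t = fderiv ℝ (fun q : Pt n => V q.1 q.2.1 q.2.2) (x, y, t) (x, y, 2 * t) := by
  have hv : ((x, y, 2 * t) : Pt n) =
      (∑ i, x i • ((Pi.single i 1, 0, 0) : Pt n)) + y • ((0, 1, 0) : Pt n)
        + (2 * t) • ((0, 0, 1) : Pt n) := by
    have hx : (∑ i, x i • ((Pi.single i 1, 0, 0) : Pt n)) = (x, 0, 0) := by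
      refine Prod.ext ?_ (Prod.ext ?_ ?_)
      · simp only [Prod.fst_sum, Prod.smul_fst]
        ext j
        simp [Finset.sum_apply, Pi.single_apply]
      · simp [Prod.snd_sum]
      · simp [Prod.snd_sum]
    rw [hx]
    simp
  rw [hv, map_add, map_add, map_sum]
  simp only [map_smul, smul_eq_mul, Zop, pdx_eq_fderiv _ h, pdy_eq_fderiv h, pdt_eq_fderiv h]

lemma SmoothAt.eventually_differentiableAt (h : SmoothAt V p) :
    ∀ᶠ q in 𝓝 p, DifferentiableAt ℝ (fun q : Pt n => V q.1 q.2.1 q.2.2) q := by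
  have h1 : ContDiffAt ℝ 1 (fun q : Pt n => V q.1 q.2.1 q.2.2) p :=
    ContDiffAt.of_le h (by exact_mod_cast le_top)
  filter_upwards [h1.eventually (by simp)] with q hq
  exact hq.differentiableAt (by simp)

lemma SmoothAt.fderiv_apply (h : SmoothAt V p) (v : Pt n) :
    ContDiffAt ℝ (⊤ : ℕ∞)
      (fun q => fderiv ℝ (fun q : Pt n => V q.1 q.2.1 q.2.2) q v) p :=
  (ContDiffAt.fderiv_right (m := (⊤ : ℕ∞)) h (by simp)).clm_apply contDiffAt_const

lemma SmoothAt.pdx (h : SmoothAt V p) (i : Fin n) :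
    SmoothAt (fun x y t => pdx i V x y t) p := by
  refine (h.fderiv_apply (Pi.single i 1, 0, 0)).congr_of_eventuallyEq ?_
  filter_upwards [h.eventually_differentiableAt] with q hq
  exact pdx_eq_fderiv i hq

lemma SmoothAt.pdy (h : SmoothAt V p) : SmoothAt (fun x y t => pdy V x y t) p := by
  refine (h.fderiv_apply (0, 1, 0)).congr_of_eventuallyEq ?_
  filter_upwards [h.eventually_differentiableAt] with q hq
  exact pdy_eq_fderiv hq

lemma SmoothAt.pdt (h : SmoothAt V p) : SmoothAt (fun x y t => pdt V x y t) p := by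
  refine (h.fderiv_apply (0, 0, 1)).congr_of_eventuallyEq ?_
  filter_upwards [h.eventually_differentiableAt] with q hq
  exact pdt_eq_fderiv hq

lemma SmoothAt.mul (hV : SmoothAt V p) (hW : SmoothAt W p) :
    SmoothAt (fun x y t => V x y t * W x y t) p :=
  ContDiffAt.mul hV hW

lemma SmoothAt.gradSq (h : SmoothAt V p) : SmoothAt (fun x y t => gradSq V x y t) p := by
  unfold SmoothAt _root_.gradSq
  exact (ContDiffAt.sum fun i _ => (ContDiffAt.pow (h.pdx i) 2)).add (ContDiffAt.pow h.pdy 2)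

lemma SmoothAt.Zop (h : SmoothAt V p) : SmoothAt (fun x y t => Zop V x y t) p := by
  unfold SmoothAt _root_.Zop
  refine ((ContDiffAt.sum fun i _ => ContDiffAt.mul ?_ (h.pdx i)).add
    (ContDiffAt.mul (by fun_prop) h.pdy)).add (ContDiffAt.mul (by fun_prop) h.pdt)
  fun_prop

lemma SmoothAt.lapFull (h : SmoothAt V p) : SmoothAt (fun x y t => lapFull V x y t) p :=
  ContDiffAt.add (ContDiffAt.sum fun i _ => (h.pdx i).pdx i) h.pdy.pdy

lemma SmoothAt.continuousAt (h : SmoothAt V p) :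
    ContinuousAt (fun q : Pt n => V q.1 q.2.1 q.2.2) p :=
  ContDiffAt.continuousAt h

lemma pdx_mul (i : Fin n) (hV : SmoothAt V (x, y, t)) (hW : SmoothAt W (x, y, t)) :
    _root_.pdx i (fun x y t => V x y t * W x y t) x y t =
      V x y t * _root_.pdx i W x y t + _root_.pdx i V x y t * W x y t := by
  have h1 := (hasFDerivAt_slice_x hV.differentiableAt).differentiableAt
  have h2 := (hasFDerivAt_slice_x hW.differentiableAt).differentiableAt
  simp only [_root_.pdx]
  rw [fderiv_fun_mul h1 h2]
  simp [mul_comm]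

lemma pdy_mul (hV : SmoothAt V (x, y, t)) (hW : SmoothAt W (x, y, t)) :
    _root_.pdy (fun x y t => V x y t * W x y t) x y t =
      V x y t * _root_.pdy W x y t + _root_.pdy V x y t * W x y t := by
  have h := (hV.hasDerivAt_pdy.mul hW.hasDerivAt_pdy).deriv
  rw [add_comm]
  exact h

end PartialDerivatives

section Weight

variable {n : ℕ} {a : ℝ} {x : Fin n → ℝ} {y t : ℝ}

lemma smoothAt_wgt (hy : 0 < y) (ht : t < 0) :
    SmoothAt (fun x y t => wgt n a (x, y, t)) (x, y, t) := by
  unfold SmoothAt wgt Gbar nsq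
  have h1 : ContDiffAt ℝ (⊤ : ℕ∞) (fun q : Pt n => |q.2.2|) (x, y, t) := by
    have : ContDiffAt ℝ (⊤ : ℕ∞) (fun q : Pt n => -q.2.2) (x, y, t) := by fun_prop
    refine this.congr_of_eventuallyEq ?_
    have ho : IsOpen {q : Pt n | q.2.2 < 0} := isOpen_lt (by fun_prop) continuous_const
    filter_upwards [ho.mem_nhds ht] with q hq
    exact abs_of_neg hq
  have h0 : |t| ≠ 0 := abs_ne_zero.2 ht.ne
  have h2 : ContDiffAt ℝ (⊤ : ℕ∞) (fun q : Pt n => q.2.1) (x, y, t) := by fun_prop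
  refine ContDiffAt.mul (ContDiffAt.mul (contDiffAt_const.mul
    (h1.rpow_const_of_ne h0)) (ContDiffAt.exp (ContDiffAt.div ?_ (contDiffAt_const.mul h1) ?_)))
    (h2.rpow_const_of_ne hy.ne')
  · fun_prop
  · simpa using ht.ne

lemma pdx_wgt (i : Fin n) (ht : t < 0) :
    pdx i (fun x y t => wgt n a (x, y, t)) x y t = x i / (2 * t) * wgt n a (x, y, t) := by
  have h1 : HasFDerivAt (fun x' : Fin n → ℝ => nsq x' y)
      (∑ j, (2 * x j) • (ContinuousLinearMap.proj j : (Fin n → ℝ) →L[ℝ] ℝ)) x := by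
    unfold nsq
    refine (HasFDerivAt.fun_sum fun j _ => ?_).add_const _
    simpa using (ContinuousLinearMap.proj (R := ℝ) (φ := fun _ : Fin n => ℝ) j).hasFDerivAt.pow 2
  have h2 := (((h1.neg.mul_const (4 * |t|)⁻¹).exp).const_mul
    ((4 * Real.pi) ^ (-(n : ℝ) / 2) / ((2:ℝ) ^ a * Real.Gamma ((a + 1) / 2)) *
    |t| ^ (-((n : ℝ) + a + 1) / 2))).mul_const (y ^ a)
  have h3 : pdx i (fun x y t => wgt n a (x, y, t)) x y t = _ :=
    congrArg (fun L : (Fin n → ℝ) →L[ℝ] ℝ => L (Pi.single i 1)) h2.fderiv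
  rw [h3]
  simp only [wgt, Gbar, abs_of_neg ht]
  simp [Pi.single_apply, div_eq_mul_inv]
  field_simp
  norm_num

lemma pdy_wgt (hy : 0 < y) (ht : t < 0) :
    pdy (fun x y t => wgt n a (x, y, t)) x y t = (y / (2 * t) + a / y) * wgt n a (x, y, t) := by
  have h1 : HasDerivAt (fun y' : ℝ => nsq x y') (2 * y) y := by
    unfold nsq
    simpa using ((hasDerivAt_id y).pow 2).const_add (∑ i, x i ^ 2)
  have h2 := (((h1.neg.mul_const (4 * |t|)⁻¹).exp).const_mul
    ((4 * Real.pi) ^ (-(n : ℝ) / 2) / ((2:ℝ) ^ a * Real.Gamma ((a + 1) / 2)) *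
    |t| ^ (-((n : ℝ) + a + 1) / 2))).mul (Real.hasDerivAt_rpow_const (p := a) (Or.inl hy.ne'))
  have h3 : pdy (fun x y t => wgt n a (x, y, t)) x y t = _ := h2.deriv
  rw [h3, Real.rpow_sub_one hy.ne']
  simp only [wgt, Gbar, abs_of_neg ht]
  simp [div_eq_mul_inv]
  field_simp
  ring

end Weight

section Strip

variable {n : ℕ}

/-- The open half-space `{y > 0}` of space points `(x, y)`. -/
def upperHalf (n : ℕ) : Set ((Fin n → ℝ) × ℝ) := {q | 0 < q.2}

lemma measurableSet_upperHalf : MeasurableSet (upperHalf n) :=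
  measurableSet_lt measurable_const measurable_snd

lemma measurableSet_Splus (r : ℝ) : MeasurableSet (Splus n r) :=
  (measurableSet_lt measurable_const (by fun_prop : Measurable fun p : Pt n => p.2.1)).inter
    (measurableSet_Ioc.preimage (by fun_prop : Measurable fun p : Pt n => p.2.2))

lemma Splus_subset_one {r : ℝ} (hr₀ : 0 ≤ r) (hr : r ≤ 1) : Splus n r ⊆ Splus n 1 := by
  rintro p ⟨h1, h2, h3⟩
  exact ⟨h1, by nlinarith, h3⟩

lemma measurePreserving_Splus (r : ℝ) :
    MeasurePreserving (MeasurableEquiv.prodAssoc : ((Fin n → ℝ) × ℝ) × ℝ ≃ᵐ Pt n)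
      ((volume.restrict (upperHalf n)).prod (volume.restrict (Set.Ioo (-(r ^ 2)) 0)))
      (volume.restrict (Splus n r)) := by
  have h := (volume_preserving_prodAssoc (α₁ := Fin n → ℝ) (β₁ := ℝ)
    (γ₁ := ℝ)).restrict_preimage_emb MeasurableEquiv.prodAssoc.measurableEmbedding (Splus n r)
  have hs : (MeasurableEquiv.prodAssoc : ((Fin n → ℝ) × ℝ) × ℝ ≃ᵐ Pt n) ⁻¹' Splus n r =
      upperHalf n ×ˢ Set.Ioc (-(r ^ 2)) 0 := by
    ext q; rfl
  rw [hs, Measure.volume_eq_prod, ← Measure.prod_restrict,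
    ← Measure.restrict_congr_set Ioo_ae_eq_Ioc] at h
  exact h

lemma ae_Splus_time_neg (r : ℝ) : ∀ᵐ p ∂(volume.restrict (Splus n r)), p.2.2 < 0 := by
  have hm : MeasurableSet {p : Pt n | p.2.2 < 0} :=
    measurableSet_lt (by fun_prop) measurable_const
  rw [← (measurePreserving_Splus (n := n) r).map_eq,
    ae_map_iff (measurePreserving_Splus r).measurable.aemeasurable hm]
  have h : ∀ᵐ t ∂(volume.restrict (Set.Ioo (-(r ^ 2)) 0)), t < (0 : ℝ) :=
    (ae_restrict_mem measurableSet_Ioo).mono fun t ht => ht.2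
  exact Measure.quasiMeasurePreserving_snd.ae h

lemma setIntegral_Splus_eq_zero {r : ℝ} {f : Pt n → ℝ} (hf : IntegrableOn f (Splus n r))
    (h : ∀ t ∈ Set.Ioo (-(r ^ 2)) 0, ∫ q in upperHalf n, f (q.1, q.2, t) = 0) :
    ∫ p in Splus n r, f p = 0 := by
  have hmp := measurePreserving_Splus (n := n) r
  have hemb := (MeasurableEquiv.prodAssoc : ((Fin n → ℝ) × ℝ) × ℝ ≃ᵐ Pt n).measurableEmbedding
  rw [← hmp.integral_comp hemb]
  refine (integral_prod_symm _ ((hmp.integrable_comp_emb hemb).2 hf)).trans ?_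
  exact setIntegral_eq_zero_of_forall_eq_zero h

end Strip

section Kernel

variable {n : ℕ}

lemma integrableOn_abs_rpow {s : ℝ} (hs : -1 < s) (r : ℝ) :
    IntegrableOn (fun t : ℝ => |t| ^ s) (Set.Ioo (-(r ^ 2)) 0) := by
  have h : IntervalIntegrable (fun t : ℝ => t ^ s) volume 0 (r ^ 2) :=
    intervalIntegral.intervalIntegrable_rpow' hs
  rw [IntervalIntegrable.iff_comp_neg, neg_zero] at h
  have h2 := h.symm
  rw [intervalIntegrable_iff_integrableOn_Ioo_of_le (by nlinarith [sq_nonneg r])] at h2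
  refine h2.congr_fun (fun t ht => ?_) measurableSet_Ioo
  simp only [abs_of_neg ht.2]

lemma integrable_gaussian_pi {β : ℝ} (hβ : 0 < β) :
    Integrable (fun x : Fin n → ℝ => Real.exp (-β * ∑ i, x i ^ 2)) := by
  have h := Integrable.fintype_prod (μ := fun _ : Fin n => (volume : Measure ℝ))
    (f := fun _ : Fin n => fun s : ℝ => Real.exp (-β * s ^ 2))
    (fun _ => integrable_exp_neg_mul_sq hβ)
  simp only [← Real.exp_sum, ← Finset.mul_sum] at h
  exact h

lemma integral_gaussian_pi (β : ℝ) :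
    ∫ x : Fin n → ℝ, Real.exp (-β * ∑ i, x i ^ 2) = √(Real.pi / β) ^ n := by
  have h := integral_fintype_prod_volume_eq_pow (ι := Fin n)
    (fun s : ℝ => Real.exp (-β * s ^ 2))
  simpa only [← Real.exp_sum, ← Finset.mul_sum, integral_gaussian, Fintype.card_fin] using h

lemma restrict_upperHalf :
    (volume.restrict (upperHalf n) : Measure ((Fin n → ℝ) × ℝ)) =
      (volume : Measure (Fin n → ℝ)).prod (volume.restrict (Set.Ioi 0)) := by
  have : upperHalf n = Set.univ ×ˢ Set.Ioi (0 : ℝ) := by ext q; simp [upperHalf]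
  rw [this, Measure.volume_eq_prod, ← Measure.prod_restrict, Measure.restrict_univ]

/-- Slice integrals of the model kernel `|t|^c y^b exp(-|X|²/(δ|t|))`. -/
lemma kernel_slice {b c δ t : ℝ} (hb : -1 < b) (hδ : 0 < δ) (ht : t < 0) :
    IntegrableOn (fun q : (Fin n → ℝ) × ℝ =>
        |t| ^ c * q.2 ^ b * Real.exp (-(nsq q.1 q.2) / (δ * |t|))) (upperHalf n) ∧
    ∫ q in upperHalf n, |t| ^ c * q.2 ^ b * Real.exp (-(nsq q.1 q.2) / (δ * |t|)) =
      (√(Real.pi * δ) ^ n * (δ ^ ((b + 1) / 2) * (1 / 2) * Real.Gamma ((b + 1) / 2))) *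
        |t| ^ (c + (n + b + 1) / 2) := by
  have ht' : 0 < |t| := abs_pos.2 ht.ne
  set β : ℝ := (δ * |t|)⁻¹ with hβ
  have hβ0 : 0 < β := by positivity
  have hfun : (fun q : (Fin n → ℝ) × ℝ =>
      |t| ^ c * q.2 ^ b * Real.exp (-(nsq q.1 q.2) / (δ * |t|))) =
      fun q => (|t| ^ c * Real.exp (-β * ∑ i, q.1 i ^ 2)) *
        (q.2 ^ b * Real.exp (-β * q.2 ^ (2 : ℝ))) := by
    funext q
    have : -(nsq q.1 q.2) / (δ * |t|) = (-β * ∑ i, q.1 i ^ 2) + (-β * q.2 ^ (2 : ℝ)) := by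
      rw [hβ, nsq, Real.rpow_two]; ring
    rw [this, Real.exp_add]; ring
  rw [hfun]
  constructor
  · rw [IntegrableOn, restrict_upperHalf]
    refine Integrable.mul_prod (f := fun x : Fin n → ℝ => |t| ^ c * Real.exp (-β * ∑ i, x i ^ 2))
      (g := fun y : ℝ => y ^ b * Real.exp (-β * y ^ (2 : ℝ)))
      ((integrable_gaussian_pi hβ0).const_mul _) ?_
    have := integrableOn_rpow_mul_exp_neg_mul_sq hβ0 hb
    simpa only [Real.rpow_two, IntegrableOn] using this
  · rw [restrict_upperHalf, integral_prod_mul (fun x : Fin n → ℝ =>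
      |t| ^ c * Real.exp (-β * ∑ i, x i ^ 2)) (fun y : ℝ => y ^ b * Real.exp (-β * y ^ (2 : ℝ))),
      integral_const_mul, integral_gaussian_pi,
      integral_rpow_mul_exp_neg_mul_rpow (by norm_num) hb hβ0]
    have e1 : √(Real.pi / β) ^ n = √(Real.pi * δ) ^ n * |t| ^ ((n : ℝ) / 2) := by
      have : Real.pi / β = (Real.pi * δ) * |t| := by rw [hβ]; field_simp
      rw [this, Real.sqrt_mul (by positivity), mul_pow, Real.sqrt_eq_rpow (|t|),
        ← Real.rpow_natCast (|t| ^ _), ← Real.rpow_mul ht'.le]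
      congr 2; ring
    have e2 : β ^ (-(b + 1) / 2) = δ ^ ((b + 1) / 2) * |t| ^ ((b + 1) / 2) := by
      rw [hβ, Real.inv_rpow (by positivity), neg_div, Real.rpow_neg (by positivity), inv_inv,
        Real.mul_rpow hδ.le ht'.le]
    rw [e1, e2, show c + (n + b + 1) / 2 = c + (n : ℝ) / 2 + (b + 1) / 2 by ring,
      Real.rpow_add ht', Real.rpow_add ht']
    ring

lemma integrableOn_kernel {b c δ : ℝ} (hb : -1 < b) (hδ : 0 < δ)
    (hc : -1 < c + (n + b + 1) / 2) (r : ℝ) :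
    IntegrableOn (fun p : Pt n => |p.2.2| ^ c * p.2.1 ^ b *
      Real.exp (-(nsq p.1 p.2.1) / (δ * |p.2.2|))) (Splus n r) := by
  have hmp := measurePreserving_Splus (n := n) r
  have hemb := (MeasurableEquiv.prodAssoc : ((Fin n → ℝ) × ℝ) × ℝ ≃ᵐ Pt n).measurableEmbedding
  rw [IntegrableOn, ← hmp.integrable_comp_emb hemb]
  have hmeas : Measurable (fun p : Pt n => |p.2.2| ^ c * p.2.1 ^ b *
      Real.exp (-(nsq p.1 p.2.1) / (δ * |p.2.2|))) := by
    unfold nsq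
    fun_prop
  rw [integrable_prod_iff' (hmeas.comp hmp.measurable).aestronglyMeasurable]
  constructor
  · filter_upwards [ae_restrict_mem measurableSet_Ioo] with t ht
    exact (kernel_slice hb hδ ht.2).1
  · refine ((integrableOn_abs_rpow hc r).const_mul (√(Real.pi * δ) ^ n *
      (δ ^ ((b + 1) / 2) * (1 / 2) * Real.Gamma ((b + 1) / 2)))).congr ?_
    filter_upwards [ae_restrict_mem measurableSet_Ioo] with t ht
    rw [← (kernel_slice (n := n) (c := c) hb hδ ht.2).2]
    refine setIntegral_congr_fun measurableSet_upperHalf fun q hq => ?_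
    have hq' : 0 < q.2 := hq
    simp only [Function.comp, MeasurableEquiv.prodAssoc, MeasurableEquiv.coe_mk,
      Equiv.prodAssoc_apply, Real.norm_eq_abs]
    refine (abs_of_nonneg ?_).symm
    positivity

end Kernel

section Scaling

variable {n : ℕ} {a : ℝ}

lemma wgt_nonneg (ha : -1 < a) {p : Pt n} (hy : 0 ≤ p.2.1) : 0 ≤ wgt n a p := by
  have : 0 < Real.Gamma ((a + 1) / 2) := Real.Gamma_pos_of_pos (by linarith)
  unfold wgt Gbar
  positivity

lemma integrableOn_wgt_mul {s b : ℝ} (hb : -1 < b + a) (hs : -1 < s + b / 2) (r : ℝ) :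
    IntegrableOn (fun p : Pt n => |p.2.2| ^ s * p.2.1 ^ b * wgt n a p) (Splus n r) := by
  have h := (integrableOn_kernel (n := n) (b := b + a) (c := s + -((n : ℝ) + a + 1) / 2) (δ := 4)
    hb (by norm_num) (by linarith) r).const_mul
    ((4 * Real.pi) ^ (-(n : ℝ) / 2) / ((2:ℝ) ^ a * Real.Gamma ((a + 1) / 2)))
  refine h.congr ?_
  filter_upwards [ae_restrict_mem (measurableSet_Splus r), ae_Splus_time_neg r] with p hp ht
  have hy : 0 < p.2.1 := hp.1
  rw [wgt, Gbar, Real.rpow_add (abs_pos.2 ht.ne), Real.rpow_add hy]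
  ring

lemma integrableOn_wgt (ha : -1 < a) (r : ℝ) : IntegrableOn (wgt n a) (Splus n r) := by
  have h := integrableOn_wgt_mul (n := n) (a := a) (s := 0) (b := 0) (by linarith) (by norm_num) r
  simpa using h

/-- The parabolic dilation `(x, y, t) ↦ (r x, r y, r² t)`. -/
def dilate (r : ℝ) (p : Pt n) : Pt n := (r • p.1, r * p.2.1, r ^ 2 * p.2.2)

lemma dilate_mem_Splus_iff {r : ℝ} (hr : 0 < r) (s : ℝ) (p : Pt n) :
    dilate r p ∈ Splus n (r * s) ↔ p ∈ Splus n s := by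
  have h2 : 0 < r ^ 2 := by positivity
  simp only [dilate, Splus, Set.mem_ofPred_eq, Set.mem_Ioc, mul_pos_iff_of_pos_left hr,
    mul_pow, ← mul_neg, mul_lt_mul_iff_right₀ h2]
  have : r ^ 2 * p.2.2 ≤ 0 ↔ p.2.2 ≤ 0 := by
    simpa using mul_le_mul_iff_right₀ (b := p.2.2) (c := 0) h2
  rw [this]

lemma nsq_dilate (r : ℝ) (p : Pt n) :
    nsq (dilate r p).1 (dilate r p).2.1 = r ^ 2 * nsq p.1 p.2.1 := by
  simp only [nsq, dilate, Pi.smul_apply, smul_eq_mul, mul_pow, mul_add, Finset.mul_sum]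

lemma wgt_dilate {r : ℝ} (hr : 0 < r) {p : Pt n} (hy : 0 ≤ p.2.1) :
    r ^ (n + 1) * wgt n a (dilate r p) = wgt n a p := by
  have h2 : (0 : ℝ) < r ^ 2 := by positivity
  have e1 : |r ^ 2 * p.2.2| = r ^ 2 * |p.2.2| := by rw [abs_mul, abs_of_pos h2]
  have e2 : -(r ^ 2 * nsq p.1 p.2.1) / (4 * (r ^ 2 * |p.2.2|)) =
      -(nsq p.1 p.2.1) / (4 * |p.2.2|) := by
    rw [show -(r ^ 2 * nsq p.1 p.2.1) = r ^ 2 * -(nsq p.1 p.2.1) by ring,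
      show 4 * (r ^ 2 * |p.2.2|) = r ^ 2 * (4 * |p.2.2|) by ring, mul_div_mul_left _ _ h2.ne']
  have e3 : r ^ (n + 1) * ((r ^ 2) ^ (-((n : ℝ) + a + 1) / 2) * r ^ a) = 1 := by
    rw [← Real.rpow_natCast r (n + 1), ← Real.rpow_natCast r 2, ← Real.rpow_mul hr.le,
      ← Real.rpow_add hr, ← Real.rpow_add hr]
    have : ((n + 1 : ℕ) : ℝ) + (((2 : ℕ) : ℝ) * (-((n : ℝ) + a + 1) / 2) + a) = 0 := by
      push_cast; ring
    rw [this, Real.rpow_zero]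
  have e4 := nsq_dilate r p
  simp only [wgt, Gbar, e4]
  simp only [dilate]
  rw [e1, e2, Real.mul_rpow h2.le (abs_nonneg _), Real.mul_rpow hr.le hy]
  linear_combination ((4 * Real.pi) ^ (-(n : ℝ) / 2) / ((2:ℝ) ^ a * Real.Gamma ((a + 1) / 2)) *
    |p.2.2| ^ (-((n : ℝ) + a + 1) / 2) * Real.exp (-(nsq p.1 p.2.1) / (4 * |p.2.2|)) *
    p.2.1 ^ a) * e3

lemma map_dilate_volume {r : ℝ} (hr : 0 < r) :
    Measure.map (dilate r) (volume : Measure (Pt n)) =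
      ENNReal.ofReal ((r ^ (n + 3))⁻¹) • volume := by
  have hd : (dilate r : Pt n → Pt n) =
      Prod.map (r • ·) (Prod.map (r • ·) ((r ^ 2) • ·)) := rfl
  have h2 : (0 : ℝ) < r ^ 2 := by positivity
  rw [hd, Measure.volume_eq_prod, Measure.volume_eq_prod,
    ← Measure.map_prod_map _ _ (by fun_prop) (by fun_prop),
    ← Measure.map_prod_map _ _ (by fun_prop) (by fun_prop),
    Measure.map_addHaar_smul _ hr.ne', Measure.map_addHaar_smul _ hr.ne',
    Measure.map_addHaar_smul _ h2.ne']
  simp only [Measure.prod_smul_left, Measure.prod_smul_right, smul_smul, Module.finrank_pi,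
    Fintype.card_fin, Module.finrank_self, pow_one]
  congr 1
  rw [abs_of_pos (by positivity), abs_of_pos (by positivity), abs_of_pos (by positivity),
    ← ENNReal.ofReal_mul (by positivity), ← ENNReal.ofReal_mul (by positivity)]
  congr 1
  rw [← mul_inv, ← mul_inv]
  ring_nf

lemma measurableEmbedding_dilate {r : ℝ} (hr : 0 < r) :
    MeasurableEmbedding (dilate r : Pt n → Pt n) :=
  ((Homeomorph.smulOfNeZero r hr.ne').prodCongr ((Homeomorph.smulOfNeZero r hr.ne').prodCongr
    (Homeomorph.smulOfNeZero (r ^ 2) (by positivity)))).measurableEmbedding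

lemma setIntegral_wgt_eq_dilate {r : ℝ} (hr : 0 < r) (f : Pt n → ℝ) :
    1 / r ^ 2 * ∫ p in Splus n r, f p * wgt n a p =
      ∫ p in Splus n 1, f (dilate r p) * wgt n a p := by
  have h := (measurableEmbedding_dilate (n := n) hr).setIntegral_map (μ := volume)
    (fun p => f p * wgt n a p) (Splus n r)
  have hpre : dilate r ⁻¹' Splus n r = Splus n 1 := by
    ext p
    simpa using dilate_mem_Splus_iff hr 1 p
  rw [map_dilate_volume hr, Measure.restrict_smul, integral_smul_measure, hpre,
    ENNReal.toReal_ofReal (by positivity), smul_eq_mul] at h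
  have h3 : ∫ p in Splus n 1, f (dilate r p) * wgt n a p =
      r ^ (n + 1) * ∫ p in Splus n 1, f (dilate r p) * wgt n a (dilate r p) := by
    rw [← integral_const_mul]
    refine setIntegral_congr_fun (measurableSet_Splus 1) fun p hp => ?_
    have hp1 : 0 < p.2.1 := hp.1
    rw [← wgt_dilate (a := a) hr hp1.le]
    ring
  rw [h3, ← h]
  field_simp
  ring
end Scaling

section Bounds

variable {n : ℕ} {a : ℝ} {F U : Fn n}

lemma mem_Splus_one {p : Pt n} : p ∈ Splus n 1 ↔ 0 < p.2.1 ∧ p.2.2 ∈ Set.Ioc (-1 : ℝ) 0 := by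
  simp [Splus]

lemma SignoriniMem.smoothAt (hU : SignoriniMem n a F U) {p : Pt n} (hp : p ∈ Splus n 1) :
    SmoothAt U p :=
  hU.smooth p.1 p.2.1 p.2.2 (mem_Splus_one.1 hp).1 (mem_Splus_one.1 hp).2

lemma pdx_eq_zero_of_far {R : ℝ} (h0 : ∀ x y t, R ^ 2 ≤ nsq x y → U x y t = 0) (i : Fin n)
    {x : Fin n → ℝ} {y t : ℝ} (h : R ^ 2 < nsq x y) : pdx i U x y t = 0 := by
  have ho : IsOpen {x' : Fin n → ℝ | R ^ 2 < nsq x' y} :=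
    isOpen_lt continuous_const (by unfold nsq; fun_prop)
  have he : (fun x' => U x' y t) =ᶠ[𝓝 x] fun _ => 0 := by
    filter_upwards [ho.mem_nhds h] with x' hx'
    exact h0 x' y t (le_of_lt hx')
  rw [pdx, he.fderiv_eq]
  simp

lemma pdy_eq_zero_of_far {R : ℝ} (h0 : ∀ x y t, R ^ 2 ≤ nsq x y → U x y t = 0)
    {x : Fin n → ℝ} {y t : ℝ} (h : R ^ 2 < nsq x y) : pdy U x y t = 0 := by
  have ho : IsOpen {y' : ℝ | R ^ 2 < nsq x y'} :=
    isOpen_lt continuous_const (by unfold nsq; fun_prop)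
  have he : (fun y' => U x y' t) =ᶠ[𝓝 y] fun _ => 0 := by
    filter_upwards [ho.mem_nhds h] with y' hy'
    exact h0 x y' t (le_of_lt hy')
  rw [pdy, he.deriv_eq]
  simp

lemma sq_le_nsq (x : Fin n → ℝ) (y : ℝ) (i : Fin n) : x i ^ 2 ≤ nsq x y := by
  have := Finset.single_le_sum (f := fun j => x j ^ 2) (fun j _ => sq_nonneg (x j))
    (Finset.mem_univ i)
  unfold nsq
  nlinarith [sq_nonneg y]

lemma sq_le_nsq' (x : Fin n → ℝ) (y : ℝ) : y ^ 2 ≤ nsq x y := by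
  have := Finset.sum_nonneg (fun j (_ : j ∈ Finset.univ) => sq_nonneg (x j))
  unfold nsq
  linarith

lemma SignoriniMem.exists_bound_pdx (hU : SignoriniMem n a F U) :
    ∃ K, 0 ≤ K ∧ ∀ i, ∀ p ∈ Splus n 1, |pdx i U p.1 p.2.1 p.2.2| ≤ K := by
  obtain ⟨R, hR, h0⟩ := hU.bddSupp
  obtain ⟨α, _, C, hC⟩ := hU.holderX
  refine ⟨|C * (R ^ 2) ^ (α / 2)|, abs_nonneg _, fun i p hp => ?_⟩
  obtain ⟨hy, ht⟩ := mem_Splus_one.1 hp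
  have hfar : pdx i U p.1 (p.2.1 + R) p.2.2 = 0 :=
    pdx_eq_zero_of_far h0 i (lt_of_lt_of_le (by nlinarith) (sq_le_nsq' p.1 (p.2.1 + R)))
  have h := hC i p.1 p.2.1 p.2.2 p.1 (p.2.1 + R) p.2.2 hy (by linarith) ht ht
  rw [hfar] at h
  simp only [sub_zero, sub_self, abs_zero, add_zero, ne_eq, OfNat.ofNat_ne_zero,
    not_false_eq_true, zero_pow, Finset.sum_const_zero, zero_add, sub_add_cancel_left,
    even_two, Even.neg_pow] at h
  exact h.trans (le_abs_self _)

lemma SignoriniMem.exists_bound_pdy (hU : SignoriniMem n a F U) :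
    ∃ K, 0 ≤ K ∧ ∀ p ∈ Splus n 1, |p.2.1 ^ a * pdy U p.1 p.2.1 p.2.2| ≤ K := by
  obtain ⟨R, hR, h0⟩ := hU.bddSupp
  obtain ⟨α, _, C, hC⟩ := hU.holderY
  refine ⟨|C * (R ^ 2) ^ (α / 2)|, abs_nonneg _, fun p hp => ?_⟩
  obtain ⟨hy, ht⟩ := mem_Splus_one.1 hp
  have hfar : pdy U p.1 (p.2.1 + R) p.2.2 = 0 :=
    pdy_eq_zero_of_far h0 (lt_of_lt_of_le (by nlinarith) (sq_le_nsq' p.1 (p.2.1 + R)))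
  have h := hC p.1 p.2.1 p.2.2 p.1 (p.2.1 + R) p.2.2 hy (by linarith) ht ht
  rw [hfar] at h
  simp only [mul_zero, sub_zero, sub_self, abs_zero, add_zero, ne_eq, OfNat.ofNat_ne_zero,
    not_false_eq_true, zero_pow, Finset.sum_const_zero, zero_add, sub_add_cancel_left,
    even_two, Even.neg_pow] at h
  exact h.trans (le_abs_self _)

lemma SignoriniMem.exists_bound (hn : 1 ≤ n) (hU : SignoriniMem n a F U) :
    ∃ K, 0 ≤ K ∧ ∀ p ∈ Splus n 1, |U p.1 p.2.1 p.2.2| ≤ K := by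
  obtain ⟨R, hR, h0⟩ := hU.bddSupp
  obtain ⟨K, hK0, hK⟩ := hU.exists_bound_pdx
  refine ⟨K * (2 * R), by positivity, fun p hp => ?_⟩
  rcases le_or_gt (R ^ 2) (nsq p.1 p.2.1) with hfar | hnear
  · rw [h0 _ _ _ hfar, abs_zero]; positivity
  obtain ⟨hy, ht⟩ := mem_Splus_one.1 hp
  let i : Fin n := ⟨0, hn⟩
  let γ : ℝ → Fin n → ℝ := fun s => p.1 + s • Pi.single i 1
  have hγ : ∀ s, HasDerivAt γ (Pi.single i 1) s := fun s => by
    have h := ((hasDerivAt_id s).smul_const (Pi.single i (1 : ℝ) : Fin n → ℝ)).const_add p.1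
    rw [one_smul] at h
    exact h
  have hd : ∀ s, HasDerivAt (fun s => U (γ s) p.2.1 p.2.2) (pdx i U (γ s) p.2.1 p.2.2) s := by
    intro s
    have hs : ((γ s, p.2.1, p.2.2) : Pt n) ∈ Splus n 1 := mem_Splus_one.2 ⟨hy, ht⟩
    have h1 := hasFDerivAt_slice_x (hU.smoothAt hs).differentiableAt
    have h2 := h1.comp_hasDerivAt s (hγ s)
    rw [pdx_eq_fderiv i (hU.smoothAt hs).differentiableAt]
    exact h2
  have hmv := Convex.norm_image_sub_le_of_norm_hasDerivWithin_le (s := Set.univ) (C := K)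
    (x := 0) (y := 2 * R) (fun s _ => (hd s).hasDerivWithinAt)
    (fun s _ => hK i (γ s, p.2.1, p.2.2) (mem_Splus_one.2 ⟨hy, ht⟩)) convex_univ
    (Set.mem_univ _) (Set.mem_univ _)
  have hz : U (γ (2 * R)) p.2.1 p.2.2 = 0 := by
    refine h0 _ _ _ (le_trans ?_ (sq_le_nsq (γ (2 * R)) p.2.1 i))
    have h1 : p.1 i ^ 2 < R ^ 2 := (sq_le_nsq p.1 p.2.1 i).trans_lt hnear
    have h2 := abs_lt_of_sq_lt_sq h1 hR.le
    have h3 : γ (2 * R) i = p.1 i + 2 * R := by simp [γ]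
    rw [h3]
    nlinarith [(abs_lt.1 h2).1]
  have hz0 : γ 0 = p.1 := by simp [γ]
  rw [hz, hz0, zero_sub, norm_neg, sub_zero, Real.norm_eq_abs, Real.norm_eq_abs,
    abs_of_pos (by positivity : 0 < 2 * R)] at hmv
  exact hmv

lemma SignoriniMem.exists_bound_Zop (hn : 1 ≤ n) (ha : a < 1) (hU : SignoriniMem n a F U) :
    ∃ K, ∀ p ∈ Splus n 1, |U p.1 p.2.1 p.2.2 * Zop U p.1 p.2.1 p.2.2| ≤ K := by
  obtain ⟨R, hR, h0⟩ := hU.bddSupp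
  obtain ⟨K₁, hK₁0, hK₁⟩ := hU.exists_bound_pdx
  obtain ⟨K₂, hK₂0, hK₂⟩ := hU.exists_bound_pdy
  obtain ⟨K₀, hK₀0, hK₀⟩ := hU.exists_bound hn
  obtain ⟨M, hM⟩ := hU.bddTime
  refine ⟨K₀ * ((∑ _i : Fin n, R * K₁) + R ^ (1 - a) * K₂ + 2 * |M|), fun p hp => ?_⟩
  rcases le_or_gt (R ^ 2) (nsq p.1 p.2.1) with hfar | hnear
  · rw [h0 _ _ _ hfar, zero_mul, abs_zero]; positivity
  obtain ⟨hy, ht⟩ := mem_Splus_one.1 hp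
  rw [abs_mul]
  refine mul_le_mul (hK₀ p hp) ?_ (abs_nonneg _) hK₀0
  unfold Zop
  refine (abs_add_le _ _).trans (add_le_add ((abs_add_le _ _).trans (add_le_add ?_ ?_)) ?_)
  · refine (Finset.abs_sum_le_sum_abs _ _).trans (Finset.sum_le_sum fun i _ => ?_)
    rw [abs_mul]
    refine mul_le_mul ?_ (hK₁ i p hp) (abs_nonneg _) hR.le
    exact abs_le_of_sq_le_sq ((sq_le_nsq p.1 p.2.1 i).trans hnear.le) hR.le
  · have e : p.2.1 * pdy U p.1 p.2.1 p.2.2 =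
        p.2.1 ^ (1 - a) * (p.2.1 ^ a * pdy U p.1 p.2.1 p.2.2) := by
      rw [← mul_assoc, ← Real.rpow_add hy]; simp
    rw [e, abs_mul, abs_of_nonneg (Real.rpow_nonneg hy.le _)]
    refine mul_le_mul (Real.rpow_le_rpow hy.le ?_ (by linarith)) (hK₂ p hp) (abs_nonneg _)
      (by positivity)
    exact (abs_le_of_sq_le_sq' ((sq_le_nsq' p.1 p.2.1).trans hnear.le) hR.le).2
  · rw [abs_mul]
    refine mul_le_mul ?_ ((hM p.1 p.2.1 p.2.2 hy ht).trans (le_abs_self _)) (abs_nonneg _)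
      (by norm_num)
    rw [abs_mul, abs_two, abs_of_nonpos ht.2]
    linarith [ht.1]

lemma SignoriniMem.exists_bound_mul_source (hn : 1 ≤ n) (hU : SignoriniMem n a F U)
    {l Cl : ℝ} (hl : 2 ≤ l) (hCl : 0 < Cl) (hF : FGrowth n F l Cl) :
    ∃ K, ∀ p ∈ Splus n 1, |U p.1 p.2.1 p.2.2 * F p.1 p.2.1 p.2.2| ≤ K := by
  obtain ⟨R, hR, h0⟩ := hU.bddSupp
  obtain ⟨K₀, hK₀0, hK₀⟩ := hU.exists_bound hn
  refine ⟨K₀ * (Cl * (R ^ 2 + 1) ^ ((l - 2) / 2)), fun p hp => ?_⟩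
  rcases le_or_gt (R ^ 2) (nsq p.1 p.2.1) with hfar | hnear
  · rw [h0 _ _ _ hfar, zero_mul, abs_zero]; positivity
  obtain ⟨hy, ht⟩ := mem_Splus_one.1 hp
  rw [abs_mul]
  refine mul_le_mul (hK₀ p hp) ((hF _ _ _ hy ht).trans ?_) (abs_nonneg _) hK₀0
  have h1 : 0 ≤ nsq p.1 p.2.1 := (sq_nonneg _).trans (sq_le_nsq' _ _)
  refine mul_le_mul_of_nonneg_left (Real.rpow_le_rpow (by positivity) ?_ (by linarith)) hCl.le
  rw [abs_of_nonpos ht.2]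
  linarith [ht.1]

end Bounds

section Measurability

variable {n : ℕ} {a : ℝ} {F U : Fn n}

lemma aestronglyMeasurable_of_smoothAt {V : Fn n} {r : ℝ} (h : ∀ p ∈ Splus n r, SmoothAt V p) :
    AEStronglyMeasurable (fun p : Pt n => V p.1 p.2.1 p.2.2) (volume.restrict (Splus n r)) :=
  ContinuousOn.aestronglyMeasurable
    (fun p hp => (h p hp).continuousAt.continuousWithinAt) (measurableSet_Splus r)

lemma SignoriniMem.aestronglyMeasurable_source (hU : SignoriniMem n a F U) :
    AEStronglyMeasurable (fun p : Pt n => F p.1 p.2.1 p.2.2) (volume.restrict (Splus n 1)) := by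
  have h : AEStronglyMeasurable (fun p : Pt n => pdt U p.1 p.2.1 p.2.2 -
      lapFull U p.1 p.2.1 p.2.2 - a / p.2.1 * pdy U p.1 p.2.1 p.2.2)
      (volume.restrict (Splus n 1)) :=
    ((aestronglyMeasurable_of_smoothAt fun p hp => (hU.smoothAt hp).pdt).sub
      (aestronglyMeasurable_of_smoothAt fun p hp => (hU.smoothAt hp).lapFull)).sub
      ((by fun_prop : Measurable fun p : Pt n => a / p.2.1).aestronglyMeasurable.mul
        (aestronglyMeasurable_of_smoothAt fun p hp => (hU.smoothAt hp).pdy))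
  refine h.congr ?_
  filter_upwards [ae_restrict_mem (measurableSet_Splus 1)] with p hp
  rw [hU.pde p.1 p.2.1 p.2.2 (mem_Splus_one.1 hp).1 (mem_Splus_one.1 hp).2]
  ring

lemma measurable_wgt : Measurable (wgt n a) := by
  unfold wgt Gbar nsq
  fun_prop

lemma integrableOn_mul_wgt_of_bound (ha : -1 < a) {f : Pt n → ℝ} {K : ℝ}
    (hf : AEStronglyMeasurable f (volume.restrict (Splus n 1)))
    (hK : ∀ p ∈ Splus n 1, |f p| ≤ K) :
    IntegrableOn (fun p => f p * wgt n a p) (Splus n 1) := by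
  refine Integrable.bdd_mul (integrableOn_wgt ha 1) hf (c := K) ?_
  filter_upwards [ae_restrict_mem (measurableSet_Splus 1)] with p hp
  exact hK p hp

lemma SignoriniMem.integrableOn_sq (hn : 1 ≤ n) (ha : -1 < a) (hU : SignoriniMem n a F U) :
    IntegrableOn (fun p => U p.1 p.2.1 p.2.2 ^ 2 * wgt n a p) (Splus n 1) := by
  obtain ⟨K, hK0, hK⟩ := hU.exists_bound hn
  refine integrableOn_mul_wgt_of_bound ha (K := K ^ 2)
    ((aestronglyMeasurable_of_smoothAt fun p hp => hU.smoothAt hp).pow 2) fun p hp => ?_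
  rw [abs_pow]
  exact pow_le_pow_left₀ (abs_nonneg _) (hK p hp) 2

lemma SignoriniMem.integrableOn_Zop (hn : 1 ≤ n) (ha : -1 < a) (ha' : a < 1)
    (hU : SignoriniMem n a F U) :
    IntegrableOn (fun p => U p.1 p.2.1 p.2.2 * Zop U p.1 p.2.1 p.2.2 * wgt n a p)
      (Splus n 1) := by
  obtain ⟨K, hK⟩ := hU.exists_bound_Zop hn ha'
  exact integrableOn_mul_wgt_of_bound ha
    ((aestronglyMeasurable_of_smoothAt fun p hp => hU.smoothAt hp).mul
      (aestronglyMeasurable_of_smoothAt fun p hp => (hU.smoothAt hp).Zop)) hK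

lemma SignoriniMem.integrableOn_mul_source (hn : 1 ≤ n) (ha : -1 < a) (hU : SignoriniMem n a F U)
    {l Cl : ℝ} (hl : 2 ≤ l) (hCl : 0 < Cl) (hF : FGrowth n F l Cl) :
    IntegrableOn (fun p => |p.2.2| * (U p.1 p.2.1 p.2.2 * F p.1 p.2.1 p.2.2) * wgt n a p)
      (Splus n 1) := by
  obtain ⟨K, hK⟩ := hU.exists_bound_mul_source hn hl hCl hF
  refine integrableOn_mul_wgt_of_bound ha (K := K)
    ((by fun_prop : Measurable fun p : Pt n => |p.2.2|).aestronglyMeasurable.mul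
    ((aestronglyMeasurable_of_smoothAt fun p hp => hU.smoothAt hp).mul
      hU.aestronglyMeasurable_source)) fun p hp => ?_
  rw [abs_mul, abs_abs]
  obtain ⟨hy, ht⟩ := mem_Splus_one.1 hp
  have h1 : |p.2.2| ≤ 1 := by rw [abs_of_nonpos ht.2]; linarith [ht.1]
  exact (mul_le_of_le_one_left (abs_nonneg _) h1).trans (hK p hp)

lemma SignoriniMem.integrableOn_gradSq (ha : -1 < a) (ha' : a < 1) (hU : SignoriniMem n a F U) :
    IntegrableOn (fun p => |p.2.2| * gradSq U p.1 p.2.1 p.2.2 * wgt n a p) (Splus n 1) := by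
  obtain ⟨K₁, hK₁0, hK₁⟩ := hU.exists_bound_pdx
  obtain ⟨K₂, hK₂0, hK₂⟩ := hU.exists_bound_pdy
  have hI : IntegrableOn (fun p : Pt n => (∑ _i : Fin n, K₁ ^ 2) * wgt n a p +
      K₂ ^ 2 * (|p.2.2| ^ (1 : ℝ) * p.2.1 ^ (-2 * a) * wgt n a p)) (Splus n 1) :=
    ((integrableOn_wgt ha 1).const_mul _).add
      ((integrableOn_wgt_mul (by linarith) (by linarith) 1).const_mul _)
  refine Integrable.mono' hI (((by fun_prop :
    Measurable fun p : Pt n => |p.2.2|).aestronglyMeasurable.mul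
    (aestronglyMeasurable_of_smoothAt fun p hp => (hU.smoothAt hp).gradSq)).mul
      measurable_wgt.aestronglyMeasurable) ?_
  filter_upwards [ae_restrict_mem (measurableSet_Splus 1)] with p hp
  obtain ⟨hy, ht⟩ := mem_Splus_one.1 hp
  have h1 : |p.2.2| ≤ 1 := by rw [abs_of_nonpos ht.2]; linarith [ht.1]
  have hw : 0 ≤ wgt n a p := wgt_nonneg ha hy.le
  have hs : ∑ i, pdx i U p.1 p.2.1 p.2.2 ^ 2 ≤ ∑ _i : Fin n, K₁ ^ 2 :=
    Finset.sum_le_sum fun i _ => sq_le_sq' (by linarith [(abs_le.1 (hK₁ i p hp)).1])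
      (abs_le.1 (hK₁ i p hp)).2
  have hs0 : 0 ≤ ∑ i, pdx i U p.1 p.2.1 p.2.2 ^ 2 := Finset.sum_nonneg fun i _ => sq_nonneg _
  have hyy : pdy U p.1 p.2.1 p.2.2 ^ 2 ≤ K₂ ^ 2 * p.2.1 ^ (-2 * a) := by
    have e : pdy U p.1 p.2.1 p.2.2 ^ 2 =
        (p.2.1 ^ a * pdy U p.1 p.2.1 p.2.2) ^ 2 * p.2.1 ^ (-2 * a) := by
      have : (p.2.1 ^ a) ^ 2 * p.2.1 ^ (-2 * a) = 1 := by
        rw [← Real.rpow_natCast, ← Real.rpow_mul hy.le, ← Real.rpow_add hy]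
        convert Real.rpow_zero _ using 2
        push_cast; ring
      linear_combination (-(pdy U p.1 p.2.1 p.2.2) ^ 2) * this
    rw [e]
    refine mul_le_mul_of_nonneg_right ?_ (Real.rpow_nonneg hy.le _)
    exact sq_le_sq' (by linarith [(abs_le.1 (hK₂ p hp)).1]) (abs_le.1 (hK₂ p hp)).2
  rw [Real.rpow_one, Real.norm_eq_abs, abs_of_nonneg (by unfold gradSq; positivity), gradSq]
  calc |p.2.2| * (∑ i, pdx i U p.1 p.2.1 p.2.2 ^ 2 + pdy U p.1 p.2.1 p.2.2 ^ 2) * wgt n a p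
      = |p.2.2| * (∑ i, pdx i U p.1 p.2.1 p.2.2 ^ 2) * wgt n a p +
        |p.2.2| * pdy U p.1 p.2.1 p.2.2 ^ 2 * wgt n a p := by ring
    _ ≤ 1 * (∑ _i : Fin n, K₁ ^ 2) * wgt n a p +
        |p.2.2| * (K₂ ^ 2 * p.2.1 ^ (-2 * a)) * wgt n a p := by gcongr
    _ = _ := by ring

end Measurability

section HeightDerivative

variable {n : ℕ} {a : ℝ} {F U : Fn n}

lemma hasDerivAt_comp_dilate {ρ : ℝ} (hρ : ρ ≠ 0) {p : Pt n} (h : SmoothAt U (dilate ρ p)) :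
    HasDerivAt (fun ρ => U (dilate ρ p).1 (dilate ρ p).2.1 (dilate ρ p).2.2)
      (ρ⁻¹ * Zop U (dilate ρ p).1 (dilate ρ p).2.1 (dilate ρ p).2.2) ρ := by
  have hd : HasDerivAt (fun ρ => dilate ρ p) (p.1, p.2.1, 2 * ρ * p.2.2) ρ := by
    have h1 : HasDerivAt (fun ρ : ℝ => ρ • p.1) p.1 ρ := by
      simpa using (hasDerivAt_id ρ).smul_const p.1
    have h2 : HasDerivAt (fun ρ : ℝ => ρ * p.2.1) p.2.1 ρ := by
      simpa using (hasDerivAt_id ρ).mul_const p.2.1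
    have h3 : HasDerivAt (fun ρ : ℝ => ρ ^ 2 * p.2.2) (2 * ρ * p.2.2) ρ := by
      simpa using ((hasDerivAt_id ρ).pow 2).mul_const p.2.2
    exact h1.prodMk (h2.prodMk h3)
  have hc := h.differentiableAt.hasFDerivAt.comp_hasDerivAt ρ hd
  have hv : ((p.1, p.2.1, 2 * ρ * p.2.2) : Pt n) =
      ρ⁻¹ • ((dilate ρ p).1, (dilate ρ p).2.1, 2 * (dilate ρ p).2.2) := by
    refine Prod.ext ?_ (Prod.ext ?_ ?_)
    · simp [dilate, smul_smul, hρ]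
    · simp [dilate, hρ]
    · simp only [dilate, Prod.smul_mk, smul_eq_mul]
      field_simp
  rw [hv, map_smul, smul_eq_mul] at hc
  have hz : Zop U (dilate ρ p).1 (dilate ρ p).2.1 (dilate ρ p).2.2 =
      fderiv ℝ (fun p : Pt n => U p.1 p.2.1 p.2.2) (dilate ρ p)
        ((dilate ρ p).1, (dilate ρ p).2.1, 2 * (dilate ρ p).2.2) :=
    Zop_eq_fderiv h.differentiableAt
  rw [hz]
  exact hc

lemma dilate_mem_Splus_one {r : ℝ} (hr : 0 < r) (hr1 : r ≤ 1) {p : Pt n} (hp : p ∈ Splus n 1) :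
    dilate r p ∈ Splus n 1 :=
  Splus_subset_one hr.le hr1 (by simpa using (dilate_mem_Splus_iff hr 1 p).2 hp)

lemma aestronglyMeasurable_comp_dilate {V : Fn n} (h : ∀ p ∈ Splus n 1, SmoothAt V p) {r : ℝ}
    (hr : 0 < r) (hr1 : r ≤ 1) :
    AEStronglyMeasurable (fun p : Pt n => V (dilate r p).1 (dilate r p).2.1 (dilate r p).2.2)
      (volume.restrict (Splus n 1)) := by
  refine ContinuousOn.aestronglyMeasurable (fun p hp => ?_) (measurableSet_Splus 1)
  have hc : Continuous (dilate r : Pt n → Pt n) := by unfold dilate; fun_prop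
  exact (ContinuousAt.comp (f := dilate r) (h _ (dilate_mem_Splus_one hr hr1 hp)).continuousAt
    hc.continuousAt).continuousWithinAt

/-- The height satisfies `H' = 4 I / r`. -/
lemma SignoriniMem.hasDerivAt_Hfn (hn : 1 ≤ n) (ha : -1 < a) (ha' : a < 1)
    (hU : SignoriniMem n a F U) {r : ℝ} (hr : r ∈ Set.Ioo (0 : ℝ) 1) :
    HasDerivAt (Hfn n a U) (4 / r * Ifn n a U r) r := by
  obtain ⟨K, hK⟩ := hU.exists_bound_Zop hn ha'
  obtain ⟨K₀, hK₀0, hK₀⟩ := hU.exists_bound hn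
  have hmeasU : ∀ ρ ∈ Set.Ioo (0 : ℝ) 1, AEStronglyMeasurable
      (fun p : Pt n => U (dilate ρ p).1 (dilate ρ p).2.1 (dilate ρ p).2.2)
      (volume.restrict (Splus n 1)) := fun ρ hρ =>
    aestronglyMeasurable_comp_dilate (fun p hp => hU.smoothAt hp) hρ.1 hρ.2.le
  have hs : Set.Ioo (r / 2) 1 ∈ 𝓝 r := Ioo_mem_nhds (by linarith [hr.1]) hr.2
  have key := hasDerivAt_integral_of_dominated_loc_of_deriv_le
    (μ := volume.restrict (Splus n 1)) (x₀ := r) (s := Set.Ioo (r / 2) 1)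
    (F := fun ρ p => U (dilate ρ p).1 (dilate ρ p).2.1 (dilate ρ p).2.2 ^ 2 * wgt n a p)
    (F' := fun ρ p => 2 * ρ⁻¹ * (U (dilate ρ p).1 (dilate ρ p).2.1 (dilate ρ p).2.2 *
      Zop U (dilate ρ p).1 (dilate ρ p).2.1 (dilate ρ p).2.2 * wgt n a p))
    (bound := fun p => 4 * r⁻¹ * (K * wgt n a p)) hs ?_ ?_ ?_ ?_ ?_ ?_
  · have hH : Hfn n a U =ᶠ[𝓝 r] fun ρ => ∫ p in Splus n 1,
        U (dilate ρ p).1 (dilate ρ p).2.1 (dilate ρ p).2.2 ^ 2 * wgt n a p := by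
      filter_upwards [Ioi_mem_nhds hr.1] with ρ hρ
      exact setIntegral_wgt_eq_dilate hρ fun p => U p.1 p.2.1 p.2.2 ^ 2
    have hI := setIntegral_wgt_eq_dilate (a := a) hr.1
      fun p : Pt n => U p.1 p.2.1 p.2.2 * Zop U p.1 p.2.1 p.2.2
    refine (key.2.congr_of_eventuallyEq hH).congr_deriv ?_
    rw [integral_const_mul, ← hI, Ifn]
    have := hr.1.ne'
    field_simp
    ring
  · filter_upwards [Ioo_mem_nhds hr.1 hr.2] with ρ hρ
    exact ((hmeasU ρ hρ).pow 2).mul measurable_wgt.aestronglyMeasurable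
  · refine integrableOn_mul_wgt_of_bound ha (K := K₀ ^ 2) ((hmeasU r hr).pow 2) fun p hp => ?_
    rw [abs_pow]
    exact pow_le_pow_left₀ (abs_nonneg _) (hK₀ _ (dilate_mem_Splus_one hr.1 hr.2.le hp)) 2
  · exact (((hmeasU r hr).mul (aestronglyMeasurable_comp_dilate
      (fun p hp => (hU.smoothAt hp).Zop) hr.1 hr.2.le)).mul
      measurable_wgt.aestronglyMeasurable).const_mul _
  · filter_upwards [ae_restrict_mem (measurableSet_Splus 1)] with p hp ρ hρ
    have hr0 := hr.1
    have hρ0 : 0 < ρ := by linarith [hρ.1]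
    have hw : 0 ≤ wgt n a p := wgt_nonneg ha (mem_Splus_one.1 hp).1.le
    have hKp := hK _ (dilate_mem_Splus_one hρ0 hρ.2.le hp)
    rw [Real.norm_eq_abs, abs_mul, abs_mul _ (wgt n a p), abs_of_nonneg hw,
      abs_of_nonneg (by positivity : 0 ≤ 2 * ρ⁻¹)]
    refine mul_le_mul ?_ (mul_le_mul_of_nonneg_right hKp hw) (by positivity) (by positivity)
    rw [← div_eq_mul_inv, ← div_eq_mul_inv, div_le_div_iff₀ hρ0 hr0]
    linarith [hρ.1]
  · exact ((integrableOn_wgt ha 1).const_mul _).const_mul _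
  · filter_upwards [ae_restrict_mem (measurableSet_Splus 1)] with p hp ρ hρ
    have hρ0 : 0 < ρ := by linarith [hρ.1, hr.1]
    have h := ((hasDerivAt_comp_dilate hρ0.ne'
      (hU.smoothAt (dilate_mem_Splus_one hρ0 hρ.2.le hp))).pow 2).mul_const (wgt n a p)
    refine h.congr_deriv ?_
    push_cast
    ring

end HeightDerivative

section Divergence

variable {n : ℕ} {V : Fn n} {R ε t : ℝ}

lemma norm_le_of_nsq_le (hR : 0 ≤ R) {q : (Fin n → ℝ) × ℝ} (h : nsq q.1 q.2 ≤ R ^ 2) :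
    ‖q‖ ≤ R := by
  rw [Prod.norm_def, max_le_iff, pi_norm_le_iff_of_nonneg hR]
  exact ⟨fun i => abs_le_of_sq_le_sq ((sq_le_nsq q.1 q.2 i).trans h) hR,
    abs_le_of_sq_le_sq ((sq_le_nsq' q.1 q.2).trans h) hR⟩

lemma integrableOn_truncated (hR : 0 ≤ R) (hε : 0 < ε) {f : (Fin n → ℝ) × ℝ → ℝ}
    (hc : ∀ q, 0 < q.2 → ContinuousAt f q) (h0 : ∀ q, R ^ 2 < nsq q.1 q.2 → f q = 0) :
    IntegrableOn f (Set.univ ×ˢ Set.Ioi ε) := by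
  have hK : IsCompact (Metric.closedBall (0 : (Fin n → ℝ) × ℝ) R ∩ {q | ε ≤ q.2}) :=
    (isCompact_closedBall _ _).inter_right (isClosed_le continuous_const continuous_snd)
  have hf : ContinuousOn f (Metric.closedBall (0 : (Fin n → ℝ) × ℝ) R ∩ {q | ε ≤ q.2}) :=
    fun q hq => (hc q (hε.trans_le hq.2)).continuousWithinAt
  refine (hf.integrableOn_compact hK).of_forall_sdiff_eq_zero
    (MeasurableSet.univ.prod measurableSet_Ioi) fun q hq => h0 q ?_
  by_contra hcon
  have hq' : ε ≤ q.2 := le_of_lt (Set.mem_prod.1 hq.1).2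
  exact hq.2 ⟨mem_closedBall_zero_iff.2 (norm_le_of_nsq_le hR (not_lt.1 hcon)), hq'⟩

lemma integrable_slice_x (hR : 0 ≤ R) {f : (Fin n → ℝ) → ℝ} {y : ℝ} (hc : Continuous f)
    (h0 : ∀ x, R ^ 2 < nsq x y → f x = 0) : Integrable f := by
  refine hc.integrable_of_hasCompactSupport
    (HasCompactSupport.intro (isCompact_closedBall (0 : Fin n → ℝ) R) fun x hx => h0 x ?_)
  by_contra hcon
  refine hx (mem_closedBall_zero_iff.2 ?_)
  exact (le_max_left _ _).trans (norm_le_of_nsq_le (q := (x, y)) hR (not_lt.1 hcon))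

lemma continuous_slice_x {y : ℝ} (hs : ∀ x, SmoothAt V (x, y, t)) :
    Continuous fun x => V x y t :=
  continuous_iff_continuousAt.2 fun x => ContinuousAt.comp
    (f := fun x : Fin n → ℝ => ((x, y, t) : Pt n)) (hs x).continuousAt (by fun_prop)

lemma continuousAt_slice {q : (Fin n → ℝ) × ℝ} (hs : SmoothAt V (q.1, q.2, t)) :
    ContinuousAt (fun q : (Fin n → ℝ) × ℝ => V q.1 q.2 t) q :=
  ContinuousAt.comp (f := fun q : (Fin n → ℝ) × ℝ => ((q.1, q.2, t) : Pt n))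
    hs.continuousAt (by fun_prop)

lemma integral_pdx_eq_zero (hR : 0 ≤ R) (i : Fin n) {y : ℝ} (hs : ∀ x, SmoothAt V (x, y, t))
    (h0 : ∀ x y t, R ^ 2 ≤ nsq x y → V x y t = 0) : ∫ x, pdx i V x y t = 0 := by
  have hfint : Integrable fun x => V x y t :=
    integrable_slice_x hR (continuous_slice_x hs) fun x hx => h0 x y t hx.le
  have hfint' : Integrable fun x => pdx i V x y t :=
    integrable_slice_x hR (continuous_slice_x (V := fun x y t => pdx i V x y t)
      fun x => (hs x).pdx i) fun x hx => pdx_eq_zero_of_far h0 i hx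
  have h := integral_bilinear_hasLineDerivAt_right_eq_neg_left_of_integrable
    (μ := (volume : Measure (Fin n → ℝ))) (f := fun _ => (1 : ℝ)) (f' := fun _ => 0)
    (g := fun x => V x y t) (g' := fun x => pdx i V x y t) (v := Pi.single i 1)
    (B := ContinuousLinearMap.mul ℝ ℝ) (by simp) (by simpa using hfint') (by simpa using hfint)
    (fun x _ => (hasFDerivAt_const (1 : ℝ) x).hasLineDerivAt _)
    (fun x _ => (hasFDerivAt_slice_x
      (hs x).differentiableAt).differentiableAt.hasFDerivAt.hasLineDerivAt _)
  simpa using h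

lemma setIntegral_pdx_eq_zero (hR : 0 ≤ R) (hε : 0 < ε) (i : Fin n)
    (hs : ∀ x y, 0 < y → SmoothAt V (x, y, t))
    (h0 : ∀ x y t, R ^ 2 ≤ nsq x y → V x y t = 0) :
    IntegrableOn (fun q : (Fin n → ℝ) × ℝ => pdx i V q.1 q.2 t) (Set.univ ×ˢ Set.Ioi ε) ∧
    ∫ q in (Set.univ : Set (Fin n → ℝ)) ×ˢ Set.Ioi ε, pdx i V q.1 q.2 t = 0 := by
  have hfint : IntegrableOn (fun q : (Fin n → ℝ) × ℝ => pdx i V q.1 q.2 t)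
      (Set.univ ×ˢ Set.Ioi ε) :=
    integrableOn_truncated hR hε (fun q hq => continuousAt_slice
      (V := fun x y t => pdx i V x y t) ((hs q.1 q.2 hq).pdx i))
      fun q hq => pdx_eq_zero_of_far h0 i hq
  refine ⟨hfint, ?_⟩
  rw [IntegrableOn, Measure.volume_eq_prod, ← Measure.prod_restrict] at hfint
  rw [Measure.volume_eq_prod, ← Measure.prod_restrict, integral_prod_symm _ hfint,
    Measure.restrict_univ]
  exact setIntegral_eq_zero_of_forall_eq_zero fun y hy =>
    integral_pdx_eq_zero hR i (fun x => hs x y (hε.trans hy)) h0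

lemma setIntegral_pdy (hR : 0 ≤ R) (hε : 0 < ε)
    (hs : ∀ x y, 0 < y → SmoothAt V (x, y, t))
    (h0 : ∀ x y t, R ^ 2 ≤ nsq x y → V x y t = 0) :
    IntegrableOn (fun q : (Fin n → ℝ) × ℝ => pdy V q.1 q.2 t) (Set.univ ×ˢ Set.Ioi ε) ∧
    ∫ q in (Set.univ : Set (Fin n → ℝ)) ×ˢ Set.Ioi ε, pdy V q.1 q.2 t = -∫ x, V x ε t := by
  have hfint : IntegrableOn (fun q : (Fin n → ℝ) × ℝ => pdy V q.1 q.2 t)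
      (Set.univ ×ˢ Set.Ioi ε) :=
    integrableOn_truncated hR hε (fun q hq => continuousAt_slice
      (V := fun x y t => pdy V x y t) (hs q.1 q.2 hq).pdy)
      fun q hq => pdy_eq_zero_of_far h0 hq
  refine ⟨hfint, ?_⟩
  rw [IntegrableOn, Measure.volume_eq_prod, ← Measure.prod_restrict] at hfint
  rw [Measure.volume_eq_prod, ← Measure.prod_restrict, integral_prod _ hfint,
    Measure.restrict_univ, ← integral_neg]
  refine integral_congr_ae ?_
  rw [Measure.restrict_univ] at hfint
  filter_upwards [hfint.prod_right_ae] with x hx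
  have ht : Tendsto (fun y => V x y t) atTop (𝓝 0) := by
    refine tendsto_const_nhds.congr' ?_
    filter_upwards [eventually_ge_atTop R] with y hy
    exact (h0 x y t ((pow_le_pow_left₀ hR hy 2).trans (sq_le_nsq' x y))).symm
  have h := integral_Ioi_of_hasDerivAt_of_tendsto' (a := ε)
    (fun y hy => (hs x y (hε.trans_le hy)).hasDerivAt_pdy) hx ht
  rw [zero_sub] at h
  exact h

end Divergence

section Identity

variable {n : ℕ} {a : ℝ} {F U : Fn n}

/-- The weighted flux of `U ∂_y U` through `{y = ε}` vanishes as `ε → 0`. -/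
lemma SignoriniMem.tendsto_flux (hn : 1 ≤ n) (ha : -1 < a) (hU : SignoriniMem n a F U) {t : ℝ}
    (ht : t ∈ Set.Ioo (-1 : ℝ) 0) {u : ℕ → ℝ} (hu : ∀ k, 0 < u k)
    (hu0 : Tendsto u atTop (𝓝 0)) :
    Tendsto (fun k => ∫ x, U x (u k) t * (pdy U x (u k) t * wgt n a (x, u k, t)))
      atTop (𝓝 0) := by
  have ht' : t ∈ Set.Ioc (-1 : ℝ) 0 := ⟨ht.1, ht.2.le⟩
  obtain ⟨K₀, hK₀0, hK₀⟩ := hU.exists_bound hn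
  obtain ⟨K₂, hK₂0, hK₂⟩ := hU.exists_bound_pdy
  have hΓ : 0 < Real.Gamma ((a + 1) / 2) := Real.Gamma_pos_of_pos (by linarith)
  have htp : 0 < |t| := abs_pos.2 ht.2.ne
  set c : ℝ := (4 * Real.pi) ^ (-(n : ℝ) / 2) / ((2:ℝ) ^ a * Real.Gamma ((a + 1) / 2)) *
    |t| ^ (-((n : ℝ) + a + 1) / 2) with hc
  have hc0 : 0 ≤ c := by positivity
  have hu' : Tendsto u atTop (𝓝[>] 0) :=
    tendsto_nhdsWithin_iff.2 ⟨hu0, Eventually.of_forall hu⟩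
  have hG : ∀ x y, Gbar n a x y t = c * Real.exp (-(nsq x y) / (4 * |t|)) := fun x y => rfl
  have hsplit : ∀ x y, U x y t * (pdy U x y t * wgt n a (x, y, t)) =
      U x y t * (y ^ a * pdy U x y t) * Gbar n a x y t := fun x y => by
    simp only [wgt]; ring
  have hlim := tendsto_integral_of_dominated_convergence (μ := (volume : Measure (Fin n → ℝ)))
    (F := fun k x => U x (u k) t * (pdy U x (u k) t * wgt n a (x, u k, t))) (f := fun _ => 0)
    (fun x => K₀ * K₂ * (c * Real.exp (-(4 * |t|)⁻¹ * ∑ i, x i ^ 2))) ?_ ?_ ?_ ?_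
  · simpa using hlim
  · intro k
    refine (continuous_slice_x
      (V := fun x y t => U x y t * (pdy U x y t * wgt n a (x, y, t)))
      fun x => ?_).aestronglyMeasurable
    have hs : SmoothAt U (x, u k, t) := hU.smoothAt (mem_Splus_one.2 ⟨hu k, ht'⟩)
    exact hs.mul (hs.pdy.mul (smoothAt_wgt (hu k) ht.2))
  · exact ((integrable_gaussian_pi (by positivity)).const_mul _).const_mul _
  · intro k
    refine Eventually.of_forall fun x => ?_
    have hp : ((x, u k, t) : Pt n) ∈ Splus n 1 := mem_Splus_one.2 ⟨hu k, ht'⟩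
    rw [hsplit, norm_mul, norm_mul, hG]
    refine mul_le_mul (mul_le_mul (hK₀ _ hp) (hK₂ _ hp) (norm_nonneg _) hK₀0) ?_
      (norm_nonneg _) (by positivity)
    rw [Real.norm_eq_abs, abs_of_nonneg (by positivity)]
    refine mul_le_mul_of_nonneg_left (Real.exp_le_exp.2 ?_) hc0
    rw [div_eq_mul_inv, mul_comm, neg_mul, mul_neg]
    refine neg_le_neg (mul_le_mul_of_nonneg_left ?_ (by positivity))
    rw [nsq]
    linarith [sq_nonneg (u k)]
  · refine Eventually.of_forall fun x => ?_
    obtain ⟨L, _, hL, hUL⟩ := hU.signorini x t ht'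
    have h1 : Tendsto (fun k => U x (u k) t) atTop (𝓝 (U x 0 t)) := by
      have hcw := hU.cont (x, 0, t) ⟨le_rfl, ht'⟩
      refine Tendsto.comp (f := fun k => ((x, u k, t) : Pt n)) hcw (tendsto_nhdsWithin_iff.2
        ⟨tendsto_const_nhds.prodMk_nhds (hu0.prodMk_nhds tendsto_const_nhds),
          Eventually.of_forall fun k => ?_⟩)
      exact ⟨(hu k).le, ht'⟩
    have h2 := hL.comp hu'
    have h3 : Tendsto (fun k => Gbar n a x (u k) t) atTop (𝓝 (Gbar n a x 0 t)) := by
      have hcont : Continuous fun y => Gbar n a x y t := by unfold Gbar nsq; fun_prop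
      exact hcont.continuousAt.tendsto.comp hu0
    have h4 := (h1.mul h2).mul h3
    rw [hUL, zero_mul] at h4
    refine h4.congr fun k => ?_
    rw [hsplit]; rfl

/-- The integrand of the energy identity is a weighted divergence. -/
lemma SignoriniMem.energy_integrand (hU : SignoriniMem n a F U) {x : Fin n → ℝ} {y t : ℝ}
    (hy : 0 < y) (ht : t ∈ Set.Ioo (-1 : ℝ) 0) :
    (U x y t * Zop U x y t - 2 * (|t| * gradSq U x y t) + 2 * (|t| * (U x y t * F x y t))) *
        wgt n a (x, y, t) =
      2 * t * ((∑ i, pdx i (fun x y t => U x y t * (pdx i U x y t * wgt n a (x, y, t))) x y t) +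
        pdy (fun x y t => U x y t * (pdy U x y t * wgt n a (x, y, t))) x y t) := by
  have ht' : t ∈ Set.Ioc (-1 : ℝ) 0 := ⟨ht.1, ht.2.le⟩
  have hs : SmoothAt U (x, y, t) := hU.smoothAt (mem_Splus_one.2 ⟨hy, ht'⟩)
  have hw := smoothAt_wgt (a := a) (x := x) hy ht.2
  have ht0 : t ≠ 0 := ht.2.ne
  have hx : ∀ i, pdx i (fun x y t => U x y t * (pdx i U x y t * wgt n a (x, y, t))) x y t =
      (U x y t * (pdx i U x y t * (x i / (2 * t)) + pdx i (fun x y t => pdx i U x y t) x y t) +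
        pdx i U x y t ^ 2) * wgt n a (x, y, t) := fun i => by
    rw [pdx_mul i hs ((hs.pdx i).mul hw), pdx_mul i (hs.pdx i) hw, pdx_wgt i ht.2]
    ring
  rw [Finset.sum_congr rfl fun i _ => hx i, pdy_mul hs (hs.pdy.mul hw), pdy_mul hs.pdy hw,
    pdy_wgt hy ht.2, ← Finset.sum_mul, Finset.sum_add_distrib, ← Finset.mul_sum,
    Finset.sum_add_distrib]
  have hsum : ∑ i, pdx i U x y t * (x i / (2 * t)) = (∑ i, x i * pdx i U x y t) / (2 * t) := by
    rw [Finset.sum_div]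
    exact Finset.sum_congr rfl fun i _ => by ring
  rw [hsum, abs_of_neg ht.2, Zop, gradSq, hU.pde x y t hy ht', lapFull, lapx, pdyy]
  field_simp
  ring

lemma SignoriniMem.energy_slice (hn : 1 ≤ n) (ha : -1 < a) (hU : SignoriniMem n a F U) {t : ℝ}
    (ht : t ∈ Set.Ioo (-1 : ℝ) 0) :
    ∫ q in upperHalf n, (U q.1 q.2 t * Zop U q.1 q.2 t - 2 * (|t| * gradSq U q.1 q.2 t) +
      2 * (|t| * (U q.1 q.2 t * F q.1 q.2 t))) * wgt n a (q.1, q.2, t) = 0 := by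
  set f : (Fin n → ℝ) × ℝ → ℝ := fun q => (U q.1 q.2 t * Zop U q.1 q.2 t -
    2 * (|t| * gradSq U q.1 q.2 t) +
      2 * (|t| * (U q.1 q.2 t * F q.1 q.2 t))) * wgt n a (q.1, q.2, t) with hf
  by_cases hfint : IntegrableOn f (upperHalf n)
  swap
  · exact integral_undef hfint
  obtain ⟨R, hR, h0⟩ := hU.bddSupp
  let u : ℕ → ℝ := fun k => 1 / ((k : ℝ) + 1)
  have hu : ∀ k, 0 < u k := fun k => Nat.one_div_pos_of_nat
  have hu0 : Tendsto u atTop (𝓝 0) := tendsto_one_div_add_atTop_nhds_zero_nat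
  have hanti : Antitone u := fun k m hkm => Nat.one_div_le_one_div hkm
  let s : ℕ → Set ((Fin n → ℝ) × ℝ) := fun k => Set.univ ×ˢ Set.Ioi (u k)
  have hUn : ⋃ k, s k = upperHalf n := by
    ext q
    simp only [s, Set.mem_iUnion, Set.mem_prod, Set.mem_univ, true_and, Set.mem_Ioi, upperHalf,
      Set.mem_ofPred_eq]
    exact ⟨fun ⟨k, hk⟩ => (hu k).trans hk, fun hq => (hu0.eventually_lt_const hq).exists⟩
  have hlim := tendsto_setIntegral_of_monotone (μ := volume) (f := f) (s := s)
    (fun k => MeasurableSet.univ.prod measurableSet_Ioi)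
    (fun k m hkm => Set.prod_mono le_rfl (Set.Ioi_subset_Ioi (hanti hkm)))
    (by rw [hUn]; exact hfint)
  rw [hUn] at hlim
  have hsm : ∀ x y, 0 < y → SmoothAt U (x, y, t) := fun x y hy =>
    hU.smoothAt (mem_Splus_one.2 ⟨hy, ht.1, ht.2.le⟩)
  have hk : ∀ k, ∫ q in s k, f q =
      2 * t * -∫ x, U x (u k) t * (pdy U x (u k) t * wgt n a (x, u k, t)) := by
    intro k
    have hX := fun i => setIntegral_pdx_eq_zero (t := t) hR.le (hu k) i
      (V := fun x y t => U x y t * (pdx i U x y t * wgt n a (x, y, t)))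
      (fun x y hy => (hsm x y hy).mul (((hsm x y hy).pdx i).mul (smoothAt_wgt hy ht.2)))
      (fun x y t h => by rw [h0 x y t h, zero_mul])
    have hY := setIntegral_pdy (t := t) hR.le (hu k)
      (V := fun x y t => U x y t * (pdy U x y t * wgt n a (x, y, t)))
      (fun x y hy => (hsm x y hy).mul ((hsm x y hy).pdy.mul (smoothAt_wgt hy ht.2)))
      (fun x y t h => by rw [h0 x y t h, zero_mul])
    have hcongr := setIntegral_congr_fun (μ := volume) (f := f)
      (MeasurableSet.univ.prod measurableSet_Ioi : MeasurableSet (s k))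
      fun q hq => hU.energy_integrand ((hu k).trans (Set.mem_prod.1 hq).2) ht
    rw [hcongr, integral_const_mul, integral_add (integrable_finsetSum _ fun i _ => (hX i).1) hY.1,
      integral_finsetSum _ fun i _ => (hX i).1, Finset.sum_eq_zero fun i _ => (hX i).2, zero_add,
      hY.2]
  have hz := ((hU.tendsto_flux hn ha ht hu hu0).neg).const_mul (2 * t)
  rw [neg_zero, mul_zero] at hz
  exact tendsto_nhds_unique hlim (hz.congr fun k => (hk k).symm)

/-- The energy identity `I = D - r⁻² ∫ |t| U F`. -/
lemma SignoriniMem.Ifn_eq (hn : 1 ≤ n) (ha : -1 < a) (ha' : a < 1) (hU : SignoriniMem n a F U)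
    {l Cl : ℝ} (hl : 2 ≤ l) (hCl : 0 < Cl) (hF : FGrowth n F l Cl) {r : ℝ}
    (hr : r ∈ Set.Ioo (0 : ℝ) 1) :
    Ifn n a U r = Dfn n a U r - 1 / r ^ 2 * ∫ p in Splus n r,
      |p.2.2| * (U p.1 p.2.1 p.2.2 * F p.1 p.2.1 p.2.2) * wgt n a p := by
  have hsub := Splus_subset_one (n := n) hr.1.le hr.2.le
  have h1 := (hU.integrableOn_Zop hn ha ha').mono_set hsub
  have h2 := (hU.integrableOn_gradSq ha ha').mono_set hsub
  have h3 := (hU.integrableOn_mul_source hn ha hl hCl hF).mono_set hsub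
  have hI := (h1.sub (h2.const_mul 2)).add (h3.const_mul 2)
  have hz := setIntegral_Splus_eq_zero hI fun t ht => by
    rw [← hU.energy_slice hn ha (t := t) ⟨by nlinarith [ht.1, hr.1, hr.2], ht.2⟩]
    refine integral_congr_ae (Eventually.of_forall fun q => ?_)
    simp only [Pi.add_apply, Pi.sub_apply]
    ring
  have hz' := (integral_add (h1.sub (h2.const_mul 2)) (h3.const_mul 2)).symm.trans hz
  rw [integral_sub' h1 (h2.const_mul 2), integral_const_mul, integral_const_mul] at hz'
  rw [Ifn, Dfn]
  linear_combination 1 / (2 * r ^ 2) * hz'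

end Identity

section SourceEstimate

variable {n : ℕ} {a : ℝ} {F U : Fn n}

lemma nsq_nonneg (x : Fin n → ℝ) (y : ℝ) : 0 ≤ nsq x y := (sq_nonneg _).trans (sq_le_nsq' x y)

lemma add_rpow_mul_exp_le {s z τ : ℝ} (hs : 0 ≤ s) (hz : 0 ≤ z) (hτ : 0 < τ) :
    (z + τ) ^ s * Real.exp (-z / (4 * τ)) ≤
      (8 * (s + 1)) ^ s * (τ ^ s * Real.exp (-z / (8 * τ))) := by
  set w : ℝ := z / τ with hw
  have hw0 : 0 ≤ w := by positivity
  have h1 : 1 + w ≤ 8 * (s + 1) * Real.exp (w / (8 * (s + 1))) := by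
    have := Real.add_one_le_exp (w / (8 * (s + 1)))
    calc 1 + w ≤ 8 * (s + 1) * (w / (8 * (s + 1)) + 1) := by field_simp; linarith
      _ ≤ _ := by gcongr
  have h2 : (1 + w) ^ s ≤ (8 * (s + 1)) ^ s * Real.exp (w / 8) := by
    refine (Real.rpow_le_rpow (by positivity) h1 hs).trans ?_
    rw [Real.mul_rpow (by positivity) (by positivity), ← Real.exp_mul]
    gcongr
    rw [div_mul_eq_mul_div, div_le_div_iff₀ (by positivity) (by norm_num)]
    nlinarith
  have e1 : z + τ = τ * (1 + w) := by rw [hw]; field_simp; ring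
  have e2 : -z / (4 * τ) = -w / 8 + -w / 8 := by rw [hw]; field_simp; ring
  have e3 : -z / (8 * τ) = -w / 8 := by rw [hw]; field_simp
  rw [e1, e2, e3, Real.mul_rpow hτ.le (by positivity), Real.exp_add]
  calc τ ^ s * (1 + w) ^ s * (Real.exp (-w / 8) * Real.exp (-w / 8))
      ≤ τ ^ s * ((8 * (s + 1)) ^ s * Real.exp (w / 8)) *
        (Real.exp (-w / 8) * Real.exp (-w / 8)) := by gcongr
    _ = (8 * (s + 1)) ^ s * (τ ^ s * Real.exp (-w / 8)) *
        (Real.exp (w / 8) * Real.exp (-w / 8)) := by ring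
    _ = _ := by rw [← Real.exp_add]; ring_nf; simp

lemma integrableOn_growth (ha : -1 < a) {s : ℝ} (hs : 0 ≤ s) :
    IntegrableOn (fun p : Pt n => p.2.2 ^ 2 * (nsq p.1 p.2.1 + |p.2.2|) ^ s * wgt n a p)
      (Splus n 1) := by
  have hΓ : 0 < Real.Gamma ((a + 1) / 2) := Real.Gamma_pos_of_pos (by linarith)
  set c : ℝ := (4 * Real.pi) ^ (-(n : ℝ) / 2) / ((2:ℝ) ^ a * Real.Gamma ((a + 1) / 2)) with hc
  have hc0 : 0 ≤ c := by positivity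
  have hI := (integrableOn_kernel (n := n) (b := a) (δ := 8)
    (c := 2 + s + -((n : ℝ) + a + 1) / 2) ha (by norm_num) (by linarith) 1).const_mul
    (c * (8 * (s + 1)) ^ s)
  refine Integrable.mono' hI (Measurable.aestronglyMeasurable ?_) ?_
  · refine Measurable.mul ?_ measurable_wgt
    unfold nsq
    fun_prop
  filter_upwards [ae_restrict_mem (measurableSet_Splus 1), ae_Splus_time_neg 1] with p hp ht
  have hy : 0 < p.2.1 := hp.1
  have htp : 0 < |p.2.2| := abs_pos.2 ht.ne
  have hz := nsq_nonneg p.1 p.2.1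
  have hw : 0 ≤ wgt n a p := wgt_nonneg ha hy.le
  rw [Real.norm_eq_abs, abs_of_nonneg (by positivity), wgt, Gbar, ← hc, ← sq_abs p.2.2]
  have hk := add_rpow_mul_exp_le hs hz htp
  have e : |p.2.2| ^ (2 + s + -((n : ℝ) + a + 1) / 2) =
      |p.2.2| ^ 2 * |p.2.2| ^ s * |p.2.2| ^ (-((n : ℝ) + a + 1) / 2) := by
    rw [Real.rpow_add htp, Real.rpow_add htp, Real.rpow_two]
  rw [e]
  calc |p.2.2| ^ 2 * (nsq p.1 p.2.1 + |p.2.2|) ^ s * (c * |p.2.2| ^ (-((n : ℝ) + a + 1) / 2) *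
        Real.exp (-nsq p.1 p.2.1 / (4 * |p.2.2|)) * p.2.1 ^ a)
      = |p.2.2| ^ 2 * c * |p.2.2| ^ (-((n : ℝ) + a + 1) / 2) * p.2.1 ^ a *
        ((nsq p.1 p.2.1 + |p.2.2|) ^ s * Real.exp (-nsq p.1 p.2.1 / (4 * |p.2.2|))) := by ring
    _ ≤ |p.2.2| ^ 2 * c * |p.2.2| ^ (-((n : ℝ) + a + 1) / 2) * p.2.1 ^ a *
        ((8 * (s + 1)) ^ s * (|p.2.2| ^ s * Real.exp (-nsq p.1 p.2.1 / (8 * |p.2.2|)))) := by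
      gcongr
    _ = _ := by ring

lemma setIntegral_growth {l r : ℝ} (hr : 0 < r) :
    1 / r ^ 2 * ∫ p in Splus n r, p.2.2 ^ 2 * (nsq p.1 p.2.1 + |p.2.2|) ^ (l - 2) * wgt n a p =
      r ^ (2 * l) *
        ∫ p in Splus n 1, p.2.2 ^ 2 * (nsq p.1 p.2.1 + |p.2.2|) ^ (l - 2) * wgt n a p := by
  rw [setIntegral_wgt_eq_dilate hr fun p : Pt n =>
    p.2.2 ^ 2 * (nsq p.1 p.2.1 + |p.2.2|) ^ (l - 2), ← integral_const_mul]
  refine integral_congr_ae (Eventually.of_forall fun p => ?_)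
  have h2 : (0 : ℝ) < r ^ 2 := by positivity
  have hr2l : r ^ (2 * l) = r ^ 4 * (r ^ 2) ^ (l - 2) := by
    rw [← Real.rpow_natCast r 4, ← Real.rpow_natCast r 2, ← Real.rpow_mul hr.le,
      ← Real.rpow_add hr]
    congr 1
    push_cast
    ring
  have hn := nsq_nonneg p.1 p.2.1
  have e : nsq (dilate r p).1 (dilate r p).2.1 + |(dilate r p).2.2| =
      r ^ 2 * (nsq p.1 p.2.1 + |p.2.2|) := by
    rw [nsq_dilate, mul_add]
    simp [dilate, abs_mul]
  beta_reduce
  rw [e, Real.mul_rpow h2.le (by positivity), hr2l]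
  simp only [dilate]
  ring

lemma SignoriniMem.abs_Dfn_sub_Ifn_le (hn : 1 ≤ n) (ha : -1 < a) (ha' : a < 1)
    (hU : SignoriniMem n a F U) {l Cl : ℝ} (hl : 2 ≤ l) (hCl : 0 < Cl) (hF : FGrowth n F l Cl)
    {r δ : ℝ} (hr : r ∈ Set.Ioo (0 : ℝ) 1) (hδ : 0 < δ) :
    |Dfn n a U r - Ifn n a U r| ≤ δ / 2 * Hfn n a U r + Cl ^ 2 / (2 * δ) * (r ^ (2 * l) *
      ∫ p in Splus n 1, p.2.2 ^ 2 * (nsq p.1 p.2.1 + |p.2.2|) ^ (l - 2) * wgt n a p) := by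
  have hsub := Splus_subset_one (n := n) hr.1.le hr.2.le
  have h1 := ((hU.integrableOn_sq hn ha).mono_set hsub).const_mul (δ / 2)
  have h2 := ((integrableOn_growth (n := n) ha (s := l - 2) (by linarith)).mono_set
    hsub).const_mul (Cl ^ 2 / (2 * δ))
  have hr0 := hr.1
  rw [hU.Ifn_eq hn ha ha' hl hCl hF hr, sub_sub_cancel, abs_mul, abs_of_pos (by positivity),
    ← setIntegral_growth hr.1, Hfn]
  have hle : |∫ p in Splus n r, |p.2.2| * (U p.1 p.2.1 p.2.2 * F p.1 p.2.1 p.2.2) * wgt n a p| ≤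
      ∫ p in Splus n r, (δ / 2 * (U p.1 p.2.1 p.2.2 ^ 2 * wgt n a p) + Cl ^ 2 / (2 * δ) *
        (p.2.2 ^ 2 * (nsq p.1 p.2.1 + |p.2.2|) ^ (l - 2) * wgt n a p)) := by
    rw [← Real.norm_eq_abs]
    refine norm_integral_le_of_norm_le (h1.add h2) ?_
    filter_upwards [ae_restrict_mem (measurableSet_Splus r)] with p hp
    obtain ⟨hy, ht⟩ := mem_Splus_one.1 (hsub hp)
    have hw : 0 ≤ wgt n a p := wgt_nonneg ha hy.le
    have hz := nsq_nonneg p.1 p.2.1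
    have hFp := hF p.1 p.2.1 p.2.2 hy ht
    have hF2 : F p.1 p.2.1 p.2.2 ^ 2 ≤ Cl ^ 2 * (nsq p.1 p.2.1 + |p.2.2|) ^ (l - 2) := by
      have h := pow_le_pow_left₀ (abs_nonneg _) hFp 2
      rw [sq_abs, mul_pow, ← Real.rpow_natCast (_ ^ _) 2, ← Real.rpow_mul (by positivity)] at h
      rwa [Nat.cast_ofNat, div_mul_cancel₀ _ two_ne_zero] at h
    rw [Real.norm_eq_abs, abs_mul, abs_of_nonneg hw, abs_mul, abs_abs, abs_mul]
    have hY : |p.2.2| * (|U p.1 p.2.1 p.2.2| * |F p.1 p.2.1 p.2.2|) ≤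
        δ / 2 * U p.1 p.2.1 p.2.2 ^ 2 + 1 / (2 * δ) * (p.2.2 ^ 2 * F p.1 p.2.1 p.2.2 ^ 2) := by
      have hsq := sq_nonneg (δ * |U p.1 p.2.1 p.2.2| - |p.2.2| * |F p.1 p.2.1 p.2.2|)
      rw [← sq_abs (U p.1 p.2.1 p.2.2), ← sq_abs p.2.2, ← sq_abs (F p.1 p.2.1 p.2.2)]
      have : δ / 2 * |U p.1 p.2.1 p.2.2| ^ 2 +
          1 / (2 * δ) * (|p.2.2| ^ 2 * |F p.1 p.2.1 p.2.2| ^ 2) -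
          |p.2.2| * (|U p.1 p.2.1 p.2.2| * |F p.1 p.2.1 p.2.2|) = 1 / (2 * δ) *
          (δ * |U p.1 p.2.1 p.2.2| - |p.2.2| * |F p.1 p.2.1 p.2.2|) ^ 2 := by
        field_simp
        ring
      have h3 : 0 ≤ 1 / (2 * δ) *
          (δ * |U p.1 p.2.1 p.2.2| - |p.2.2| * |F p.1 p.2.1 p.2.2|) ^ 2 := by positivity
      linarith
    calc |p.2.2| * (|U p.1 p.2.1 p.2.2| * |F p.1 p.2.1 p.2.2|) * wgt n a p
        ≤ (δ / 2 * U p.1 p.2.1 p.2.2 ^ 2 +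
          1 / (2 * δ) * (p.2.2 ^ 2 * F p.1 p.2.1 p.2.2 ^ 2)) * wgt n a p := by gcongr
      _ ≤ (δ / 2 * U p.1 p.2.1 p.2.2 ^ 2 + 1 / (2 * δ) * (p.2.2 ^ 2 *
          (Cl ^ 2 * (nsq p.1 p.2.1 + |p.2.2|) ^ (l - 2)))) * wgt n a p := by gcongr
      _ = _ := by ring
  rw [integral_add h1 h2, integral_const_mul, integral_const_mul] at hle
  calc _ ≤ 1 / r ^ 2 * _ := mul_le_mul_of_nonneg_left hle (by positivity)
    _ = _ := by ring

/-- The frequencies built on `D` and on `I` differ by `O(r^(1-σ))` where `H` is not truncated. -/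
lemma SignoriniMem.exists_frequency_bound (hn : 1 ≤ n) (ha : -1 < a) (ha' : a < 1)
    (hU : SignoriniMem n a F U) {l Cl σ : ℝ} (hl : 2 ≤ l) (hCl : 0 < Cl)
    (hF : FGrowth n F l Cl) :
    ∃ K, ∀ r ∈ Set.Ioo (0 : ℝ) 1, r ^ (2 * l - 2 + 2 * σ) ≤ Hfn n a U r →
      |2 * Dfn n a U r / Hfn n a U r - 2 * Ifn n a U r / Hfn n a U r| ≤ K * r ^ (1 - σ) := by
  set E := ∫ p in Splus n 1, p.2.2 ^ 2 * (nsq p.1 p.2.1 + |p.2.2|) ^ (l - 2) * wgt n a p with hE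
  have hE0 : 0 ≤ E := by
    refine setIntegral_nonneg (measurableSet_Splus 1) fun p hp => ?_
    have hw : 0 ≤ wgt n a p := wgt_nonneg ha (mem_Splus_one.1 hp).1.le
    have hz := nsq_nonneg p.1 p.2.1
    positivity
  refine ⟨1 + Cl ^ 2 * E, fun r hr hH => ?_⟩
  have hr0 := hr.1
  have hpos : 0 < Hfn n a U r := (Real.rpow_pos_of_pos hr0 _).trans_le hH
  have hδ : 0 < r ^ (1 - σ) := Real.rpow_pos_of_pos hr0 _
  have h := hU.abs_Dfn_sub_Ifn_le hn ha ha' hl hCl hF hr hδ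
  rw [← hE] at h
  have e : r ^ (2 * l) = r ^ (1 - σ) * r ^ (1 - σ) * r ^ (2 * l - 2 + 2 * σ) := by
    rw [← Real.rpow_add hr0, ← Real.rpow_add hr0]
    congr 1
    ring
  rw [← sub_div, abs_div, abs_of_pos hpos, div_le_iff₀ hpos, ← mul_sub, abs_mul, abs_two]
  calc 2 * |Dfn n a U r - Ifn n a U r|
      ≤ 2 * (r ^ (1 - σ) / 2 * Hfn n a U r +
        Cl ^ 2 / (2 * r ^ (1 - σ)) * (r ^ (2 * l) * E)) := by gcongr
    _ = r ^ (1 - σ) * Hfn n a U r +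
        Cl ^ 2 * E * r ^ (1 - σ) * r ^ (2 * l - 2 + 2 * σ) := by
      rw [e]; field_simp
    _ ≤ r ^ (1 - σ) * Hfn n a U r + Cl ^ 2 * E * r ^ (1 - σ) * Hfn n a U r := by gcongr
    _ = _ := by ring

end SourceEstimate

section FrequencyLimit

variable {n : ℕ} {a : ℝ} {F U : Fn n} {l σ C κ : ℝ}

lemma tendsto_exp_const_mul_rpow (hσ : σ < 1) (C : ℝ) :
    Tendsto (fun r : ℝ => Real.exp (C * r ^ (1 - σ))) (𝓝 0) (𝓝 1) := by
  have h : ContinuousAt (fun r : ℝ => Real.exp (C * r ^ (1 - σ))) 0 :=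
    ((Real.continuousAt_rpow_const 0 (1 - σ) (Or.inr (by linarith))).const_mul C).rexp
  simpa [ContinuousAt, Real.zero_rpow (by linarith : 1 - σ ≠ 0)] using h

lemma hasDerivAt_logMaxH_of_lt {r : ℝ} (hr : 0 < r) (hc : ContinuousAt (Hfn n a U) r)
    (h : Hfn n a U r < r ^ (2 * l - 2 + 2 * σ)) :
    HasDerivAt (logMaxH n a U l σ) ((2 * l - 2 + 2 * σ) / r) r := by
  have h1 : HasDerivAt (fun r => (2 * l - 2 + 2 * σ) * Real.log r)
      ((2 * l - 2 + 2 * σ) / r) r := by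
    simpa [div_eq_mul_inv] using (Real.hasDerivAt_log hr.ne').const_mul (2 * l - 2 + 2 * σ)
  refine h1.congr_of_eventuallyEq ?_
  filter_upwards [hc.eventually_lt (Real.continuousAt_rpow_const r _ (Or.inl hr.ne')) h,
    Ioi_mem_nhds hr] with ρ hρ hρ0
  rw [logMaxH, max_eq_right hρ.le, Real.log_rpow hρ0]

/-- If `H` falls below the truncation level at arbitrarily small radii, the limit frequency is
the truncation exponent. -/
lemma limit_eq_of_frequently_lt (hσ : σ < 1)
    (hH : ∀ r ∈ Set.Ioo (0 : ℝ) 1, ContinuousAt (Hfn n a U) r)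
    (hκ : Tendsto (Phi n a U l σ C) (𝓝[diffSet n a U l σ] 0) (𝓝 κ))
    (hf : ∃ᶠ r in 𝓝[>] (0 : ℝ), Hfn n a U r < r ^ (2 * l - 2 + 2 * σ)) :
    κ = l - 1 + σ := by
  set A : Set ℝ := {r | r ∈ Set.Ioo (0 : ℝ) 1 ∧ Hfn n a U r < r ^ (2 * l - 2 + 2 * σ)} with hA
  have hd : ∀ r ∈ A, HasDerivAt (logMaxH n a U l σ) ((2 * l - 2 + 2 * σ) / r) r :=
    fun r hr => hasDerivAt_logMaxH_of_lt hr.1.1 (hH r hr.1) hr.2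
  have hsub : A ⊆ diffSet n a U l σ := fun r hr => ⟨hr.1, (hd r hr).differentiableAt⟩
  have hne : (𝓝[A] (0 : ℝ)).NeBot := by
    rw [← mem_closure_iff_nhdsWithin_neBot, mem_closure_iff_frequently]
    have h := hf.and_eventually (Ioo_mem_nhdsGT (zero_lt_one' ℝ))
    exact (h.filter_mono nhdsWithin_le_nhds).mono fun r hr => ⟨hr.2, hr.1⟩
  have hexp := tendsto_nhdsWithin_of_tendsto_nhds (s := A) (tendsto_exp_const_mul_rpow hσ C)
  have hlim := (hexp.mul_const (l - 1 + σ)).add ((hexp.sub_const 1).const_mul 2)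
  simp only [one_mul, sub_self, mul_zero, add_zero] at hlim
  refine tendsto_nhds_unique (hκ.mono_left (nhdsWithin_mono _ hsub)) (hlim.congr' ?_)
  filter_upwards [self_mem_nhdsWithin] with r hr
  have hr0 := hr.1.1.ne'
  rw [Phi, (hd r hr).deriv]
  field_simp

lemma hasDerivAt_log_Hfn {r : ℝ} (hpos : 0 < Hfn n a U r)
    (hd : HasDerivAt (Hfn n a U) (4 / r * Ifn n a U r) r) :
    HasDerivAt (fun r => Real.log (Hfn n a U r)) (2 / r * (2 * Ifn n a U r / Hfn n a U r)) r :=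
  (hd.log hpos.ne').congr_deriv (by ring)

/-- Where `H` stays above the truncation level, the limit frequency is that of `N`. -/
lemma tendsto_frequency (hσ : σ < 1)
    (hH : ∀ r ∈ Set.Ioo (0 : ℝ) 1, HasDerivAt (Hfn n a U) (4 / r * Ifn n a U r) r)
    (hκ : Tendsto (Phi n a U l σ C) (𝓝[diffSet n a U l σ] 0) (𝓝 κ))
    {r₀ : ℝ} (hr₀ : 0 < r₀) (hr₁ : r₀ ≤ 1)
    (hge : ∀ r, 0 < r → r < r₀ → r ^ (2 * l - 2 + 2 * σ) ≤ Hfn n a U r) :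
    Tendsto (fun r => 2 * Ifn n a U r / Hfn n a U r) (𝓝[>] (0 : ℝ)) (𝓝 κ) := by
  have hd : ∀ r ∈ Set.Ioo 0 r₀, HasDerivAt (logMaxH n a U l σ)
      (2 / r * (2 * Ifn n a U r / Hfn n a U r)) r := by
    intro r hr
    have hpos : 0 < Hfn n a U r := (Real.rpow_pos_of_pos hr.1 _).trans_le (hge r hr.1 hr.2)
    refine (hasDerivAt_log_Hfn hpos
      (hH r ⟨hr.1, hr.2.trans_le hr₁⟩)).congr_of_eventuallyEq ?_
    filter_upwards [Ioo_mem_nhds hr.1 hr.2] with ρ hρ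
    rw [logMaxH, max_eq_left (hge ρ hρ.1 hρ.2)]
  have hsub : Set.Ioo 0 r₀ ⊆ diffSet n a U l σ := fun r hr =>
    ⟨⟨hr.1, hr.2.trans_le hr₁⟩, (hd r hr).differentiableAt⟩
  have hle : 𝓝[>] (0 : ℝ) ≤ 𝓝[diffSet n a U l σ] 0 := by
    rw [← nhdsWithin_Ioo_eq_nhdsGT hr₀]
    exact nhdsWithin_mono _ hsub
  have hexp := tendsto_nhdsWithin_of_tendsto_nhds (s := Set.Ioi 0)
    (tendsto_exp_const_mul_rpow hσ C)
  have hlim := ((hκ.mono_left hle).sub ((hexp.sub_const 1).const_mul 2)).div hexp one_ne_zero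
  simp only [sub_self, mul_zero, sub_zero, div_one] at hlim
  refine hlim.congr' ?_
  filter_upwards [Ioo_mem_nhdsGT hr₀] with r hr
  have hr0 := hr.1.ne'
  have he := (Real.exp_pos (C * r ^ (1 - σ))).ne'
  simp only [Pi.div_apply]
  rw [Phi, (hd r hr).deriv]
  field_simp
  ring

/-- A lower power bound on `H` bounds the limit of the frequency from above. -/
lemma limit_le_of_rpow_le {β : ℝ}
    (hH : ∀ r ∈ Set.Ioo (0 : ℝ) 1, HasDerivAt (Hfn n a U) (4 / r * Ifn n a U r) r)
    {r₀ : ℝ} (hr₀ : 0 < r₀) (hr₁ : r₀ ≤ 1)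
    (hge : ∀ r, 0 < r → r < r₀ → r ^ (2 * β) ≤ Hfn n a U r)
    (hN : Tendsto (fun r => 2 * Ifn n a U r / Hfn n a U r) (𝓝[>] (0 : ℝ)) (𝓝 κ)) :
    κ ≤ β := by
  by_contra! hlt
  obtain ⟨γ, hβγ, hγκ⟩ := exists_between hlt
  obtain ⟨r₂, hr₂, hN₂⟩ := mem_nhdsGT_iff_exists_Ioo_subset.1
    ((hN.eventually_const_lt hγκ).and (Ioo_mem_nhdsGT hr₀))
  have hr₂0 : (0 : ℝ) < r₂ := hr₂
  have hder : ∀ r ∈ Set.Ioo 0 r₂, HasDerivAt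
      (fun r => Real.log (Hfn n a U r) - 2 * γ * Real.log r)
      (2 / r * (2 * Ifn n a U r / Hfn n a U r) - 2 * γ * r⁻¹) r := fun r hr => by
    obtain ⟨_, hr'⟩ := hN₂ hr
    have hpos : 0 < Hfn n a U r := (Real.rpow_pos_of_pos hr'.1 _).trans_le (hge r hr'.1 hr'.2)
    exact (hasDerivAt_log_Hfn hpos (hH r ⟨hr'.1, hr'.2.trans_le hr₁⟩)).sub
      ((Real.hasDerivAt_log hr'.1.ne').const_mul _)
  have hmono : MonotoneOn (fun r => Real.log (Hfn n a U r) - 2 * γ * Real.log r)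
      (Set.Ioo 0 r₂) := by
    refine monotoneOn_of_deriv_nonneg (convex_Ioo _ _)
      (fun r hr => (hder r hr).continuousAt.continuousWithinAt)
      (fun r hr => (hder r (interior_subset hr)).differentiableAt.differentiableWithinAt)
      fun r hr => ?_
    have hr' := interior_subset hr
    have hr0 : 0 < r := hr'.1
    rw [(hder r hr').deriv]
    have hg : γ < 2 * Ifn n a U r / Hfn n a U r := (hN₂ hr').1
    have e : 2 / r * (2 * Ifn n a U r / Hfn n a U r) - 2 * γ * r⁻¹ =
        2 / r * (2 * Ifn n a U r / Hfn n a U r - γ) := by ring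
    rw [e]
    exact mul_nonneg (by positivity) (sub_nonneg.2 hg.le)
  have hhalf : r₂ / 2 ∈ Set.Ioo 0 r₂ := ⟨by positivity, by linarith⟩
  have htop : Tendsto (fun r => (2 * β - 2 * γ) * Real.log r) (𝓝[>] 0) atTop :=
    Real.tendsto_log_nhdsGT_zero.const_mul_atBot_of_neg (by linarith)
  obtain ⟨r, hbig, hr⟩ := ((htop.eventually_gt_atTop (Real.log (Hfn n a U (r₂ / 2)) -
    2 * γ * Real.log (r₂ / 2))).and (Ioo_mem_nhdsGT hhalf.1)).exists
  have hr' : r ∈ Set.Ioo 0 r₂ := ⟨hr.1, hr.2.trans hhalf.2⟩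
  have h1 := hmono hr' hhalf hr.2.le
  have h2 : 2 * β * Real.log r ≤ Real.log (Hfn n a U r) := by
    rw [← Real.log_rpow hr.1]
    exact Real.log_le_log (Real.rpow_pos_of_pos hr.1 _) (hge r hr.1 (hN₂ hr').2.2)
  simp only at h1
  linarith

end FrequencyLimit

/-- Lemma 6.1 on the truncated frequency limit. -/
theorem frequency_limit_properties (n : ℕ) (hn : 1 ≤ n) (a : ℝ) (ha₁ : -1 < a) (ha₂ : a < 1)
    (F U : Fn n) (hU : SignoriniMem n a F U)
    (l Cl : ℝ) (hl : 2 ≤ l) (hCl : 0 < Cl) (hF : FGrowth n F l Cl)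
    (σ : ℝ) (hσ : σ ∈ Set.Ioo (0 : ℝ) 1) (C : ℝ) (hC : 0 < C)
    (hmono : ∀ r₁ ∈ diffSet n a U l σ, ∀ r₂ ∈ diffSet n a U l σ, r₁ ≤ r₂ →
      Phi n a U l σ C r₁ ≤ Phi n a U l σ C r₂)
    (κ : ℝ) (hκ : Tendsto (Phi n a U l σ C) (𝓝[diffSet n a U l σ] 0) (𝓝 κ)) :
    κ ≤ l - 1 + σ ∧
    (κ < l - 1 + σ →
      (∃ r₀ > (0:ℝ), ∀ r : ℝ, 0 < r → r < r₀ → r ^ (2 * l - 2 + 2 * σ) ≤ Hfn n a U r) ∧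
      Tendsto (fun r => r * deriv (Hfn n a U) r / (2 * Hfn n a U r))
        (𝓝[{r : ℝ | r ∈ Set.Ioo (0 : ℝ) 1 ∧ DifferentiableAt ℝ (Hfn n a U) r}] 0)
        (𝓝 κ) ∧
      Tendsto (fun r => 2 * Ifn n a U r / Hfn n a U r) (𝓝[>] (0 : ℝ)) (𝓝 κ) ∧
      Tendsto (fun r => 2 * Dfn n a U r / Hfn n a U r) (𝓝[>] (0 : ℝ)) (𝓝 κ)) := by
  have hd : ∀ r ∈ Set.Ioo (0 : ℝ) 1, HasDerivAt (Hfn n a U) (4 / r * Ifn n a U r) r :=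
    fun r hr => hU.hasDerivAt_Hfn hn ha₁ ha₂ hr
  by_cases hf : ∃ᶠ r in 𝓝[>] (0 : ℝ), Hfn n a U r < r ^ (2 * l - 2 + 2 * σ)
  · have h := limit_eq_of_frequently_lt hσ.2 (fun r hr => (hd r hr).continuousAt) hκ hf
    exact ⟨h.le, fun h' => absurd h h'.ne⟩
  simp only [not_frequently, not_lt] at hf
  obtain ⟨r₀, hr₀, hge⟩ := mem_nhdsGT_iff_exists_Ioo_subset.1
    (hf.and (Ioo_mem_nhdsGT (zero_lt_one' ℝ)))
  have hr₀1 : 0 < min r₀ 1 := lt_min hr₀ one_pos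
  have hge' : ∀ r, 0 < r → r < min r₀ 1 → r ^ (2 * l - 2 + 2 * σ) ≤ Hfn n a U r :=
    fun r h1 h2 => (hge ⟨h1, h2.trans_le (min_le_left _ _)⟩).1
  have hN := tendsto_frequency hσ.2 hd hκ hr₀1 (min_le_right _ _) hge'
  refine ⟨limit_le_of_rpow_le hd hr₀1 (min_le_right _ _) (fun r h1 h2 => ?_) hN, fun _ =>
    ⟨⟨_, hr₀1, hge'⟩, ?_, hN, ?_⟩⟩
  · rw [show 2 * (l - 1 + σ) = 2 * l - 2 + 2 * σ by ring]
    exact hge' r h1 h2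
  · refine (hN.mono_left (nhdsWithin_mono _ fun r hr => hr.1.1)).congr' ?_
    filter_upwards [self_mem_nhdsWithin] with r hr
    have hr0 := hr.1.1.ne'
    rw [(hd r hr.1).deriv]
    field_simp
    ring
  · obtain ⟨K, hK⟩ := hU.exists_frequency_bound (σ := σ) hn ha₁ ha₂ hl hCl hF
    have hz : Tendsto (fun r : ℝ => K * r ^ (1 - σ)) (𝓝[>] 0) (𝓝 0) := by
      have hc : ContinuousAt (fun r : ℝ => K * r ^ (1 - σ)) 0 :=
        (Real.continuousAt_rpow_const 0 (1 - σ) (Or.inr (by linarith [hσ.2]))).const_mul K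
      refine tendsto_nhdsWithin_of_tendsto_nhds ?_
      simpa [ContinuousAt, Real.zero_rpow (by linarith [hσ.2] : 1 - σ ≠ 0)] using hc
    have hdiff : Tendsto (fun r => 2 * Dfn n a U r / Hfn n a U r -
        2 * Ifn n a U r / Hfn n a U r) (𝓝[>] 0) (𝓝 0) := by
      refine squeeze_zero_norm' ?_ hz
      filter_upwards [Ioo_mem_nhdsGT hr₀1] with r hr
      exact hK r ⟨hr.1, hr.2.trans_le (min_le_right _ _)⟩ (hge' r hr.1 hr.2)
    simpa using hdiff.add hN
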